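/- arXiv:math/0510025 — 14 statements merged into one kernel-verified Lean document; each statement's English description precedes it below -/
import Mathlib

section
/- Let k be a field with char k ≠ 2, let R = k[x_{i,j} : 1 ≤ i ≤ 2, 1 ≤ j ≤ 3], and let I_2(2,3) ⊆ R be the ideal generated by the permanents of the three 2×2 submatrices of the generic 2×3 matrix (x_{i,j}). Then every prime ideal 𝔭 of R containing I_2(2,3) either contains an entire row {x_{i,1}, x_{i,2}, x_{i,3}} for some i ∈ {1,2}, or contains an entire column {x_{1,j}, x_{2,j}} for some j ∈ {1,2,3}. -/
open MvPolynomial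

/-- The ideal of `d × d` subpermanents of the generic `m × n` matrix. -/
noncomputable def permIdeal (k : Type*) [Field k] (d m n : ℕ) :
    Ideal (MvPolynomial (Fin m × Fin n) k) :=
  Ideal.span {p | ∃ (r : Fin d → Fin m) (c : Fin d → Fin n), StrictMono r ∧ StrictMono c ∧
    p = Matrix.permanent (Matrix.of fun i j => X (r i, c j))}

/-- If an entry of a two-row matrix with vanishing subpermanents vanishes, then so does its row or
its column. -/
theorem row_or_column_eq_zero_of_entry_eq_zero {A ι : Type*} [CommRing A] [IsDomain A]
    {a b : ι → A} (h : ∀ i j, i ≠ j → a i * b j + a j * b i = 0) {i : ι} (hi : a i = 0) :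
    (∀ j, a j = 0) ∨ (a i = 0 ∧ b i = 0) := by
  by_cases hb : b i = 0
  · exact Or.inr ⟨hi, hb⟩
  · refine Or.inl fun j => ?_
    by_cases hij : i = j
    · exact hij ▸ hi
    · simpa [hi, hb] using h i j hij

/-- A `2 × 3` matrix over a domain of characteristic not two, all of whose `2 × 2` subpermanents
vanish, has a zero row or a zero column. -/
theorem exists_zero_row_or_column {A : Type*} [CommRing A] [IsDomain A] (h2 : (2 : A) ≠ 0)
    {a b : Fin 3 → A} (h : ∀ i j, i ≠ j → a i * b j + a j * b i = 0) :
    (∀ j, a j = 0) ∨ (∀ j, b j = 0) ∨ ∃ j, a j = 0 ∧ b j = 0 := by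
  have hprod : 2 * (a 0 * a 1 * b 2) = 0 := by
    linear_combination a 1 * h 0 2 (by decide) + a 0 * h 1 2 (by decide) -
      a 2 * h 0 1 (by decide)
  have h' : ∀ i j, i ≠ j → b i * a j + b j * a i = 0 := fun i j hij => by
    linear_combination h i j hij
  have ha : ∀ i, a i = 0 → _ := fun i hi => row_or_column_eq_zero_of_entry_eq_zero h hi
  have hb : ∀ i, b i = 0 → _ := fun i hi => row_or_column_eq_zero_of_entry_eq_zero h' hi
  simp only [mul_eq_zero, h2, false_or] at hprod
  rcases hprod with (h0 | h0) | h0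
  · exact (ha 0 h0).imp_right fun hc => Or.inr ⟨0, hc⟩
  · exact (ha 1 h0).imp_right fun hc => Or.inr ⟨1, hc⟩
  · exact Or.inr ((hb 2 h0).imp_right fun hc => ⟨2, hc.symm⟩)

/-- The `2 × 2` subpermanent on two columns `i < j` of the generic `2 × n` matrix. -/
theorem mul_add_mul_mem_permIdeal (k : Type*) [Field k] {n : ℕ} {i j : Fin n} (hij : i < j) :
    (X (0, i) * X (1, j) + X (0, j) * X (1, i) : MvPolynomial (Fin 2 × Fin n) k) ∈
      permIdeal k 2 2 n := by
  refine Ideal.subset_span ⟨id, ![i, j], strictMono_id, ?_, ?_⟩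
  · simpa [Fin.strictMono_iff_lt_succ] using hij
  · have hu : (Finset.univ : Finset (Equiv.Perm (Fin 2))) = {1, Equiv.swap 0 1} := by decide
    have hne : (1 : Equiv.Perm (Fin 2)) ≠ Equiv.swap 0 1 := by decide
    simp [Matrix.permanent, hu, Finset.sum_pair hne, mul_comm]

theorem stmt0 (k : Type*) [Field k] (hchar : ringChar k ≠ 2)
    (𝔭 : Ideal (MvPolynomial (Fin 2 × Fin 3) k)) (hp : 𝔭.IsPrime)
    (hI : permIdeal k 2 2 3 ≤ 𝔭) :
    (∃ i : Fin 2, ∀ j : Fin 3, X (i, j) ∈ 𝔭) ∨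
      (∃ j : Fin 3, ∀ i : Fin 2, X (i, j) ∈ 𝔭) := by
  have h2 : (2 : MvPolynomial (Fin 2 × Fin 3) k ⧸ 𝔭) ≠ 0 := by
    have := (algebraMap k (MvPolynomial (Fin 2 × Fin 3) k ⧸ 𝔭)).injective.ne
      (Ring.two_ne_zero hchar)
    simpa only [map_ofNat, map_zero] using this
  have hlt : ∀ i j : Fin 3, i < j → Ideal.Quotient.mk 𝔭 (X (0, i)) *
      Ideal.Quotient.mk 𝔭 (X (1, j)) + Ideal.Quotient.mk 𝔭 (X (0, j)) *
      Ideal.Quotient.mk 𝔭 (X (1, i)) = 0 := fun i j hij => by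
    simpa only [map_add, map_mul] using
      Ideal.Quotient.eq_zero_iff_mem.2 (hI (mul_add_mul_mem_permIdeal k hij))
  have h := exists_zero_row_or_column h2 (a := fun j => Ideal.Quotient.mk 𝔭 (X (0, j)))
    (b := fun j => Ideal.Quotient.mk 𝔭 (X (1, j))) fun i j hij =>
      hij.lt_or_gt.elim (hlt i j) fun hji => (add_comm _ _).trans (hlt j i hji)
  simp only [Ideal.Quotient.eq_zero_iff_mem] at h
  rcases h with h | h | ⟨j, h⟩
  · exact Or.inl ⟨0, h⟩
  · exact Or.inl ⟨1, h⟩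
  · exact Or.inr ⟨j, Fin.forall_fin_two.2 h⟩
end

section
/- Let k be a field, let d ≥ 1 and n ≥ d, and let A be any d×n matrix over k with columns c_1, …, c_n. Define a matrix H whose rows are indexed by i ∈ {1, …, n} and whose columns are indexed by multisets 𝒥 of cardinality d-1 with elements from {1, …, n}, with entry H_{i,𝒥} equal to the permanent of the d×d matrix whose columns are c_i together with the columns c_j for j ∈ 𝒥 (taken with multiplicity). Then the rank of H is at most d; equivalently, every (d+1)×(d+1) minor of H vanishes. -/
/-- The matrix `H`, whose rows are indexed by `i ∈ {1, …, n}` and whose columns are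
indexed by (tuples representing) multisets `𝒥` of cardinality `d - 1` with elements in
`{1, …, n}`, with entry the permanent of the `d × d` matrix whose columns are
`c_i` together with `c_j` for `j ∈ 𝒥`, has rank at most `d`. -/
theorem stmt2 (k : Type*) [Field k] (d n : ℕ) (hd : 1 ≤ d) (hn : d ≤ n)
    (A : Matrix (Fin d) (Fin n) k)
    (H : Matrix (Fin n) (Fin (d - 1) → Fin n) k)
    (hH : ∀ (i : Fin n) (J : Fin (d - 1) → Fin n),
      H i J = Matrix.permanent (Matrix.of fun (r : Fin d) (c : Fin d) =>
        if h : (c : ℕ) = 0 then A r i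
        else A r (J ⟨(c : ℕ) - 1, by have := c.isLt; omega⟩))) :
    H.rank ≤ d := by
  obtain ⟨m, rfl⟩ : ∃ m, d = m + 1 := ⟨d - 1, by omega⟩
  have hfactor : H = A.transpose * Matrix.of fun (r : Fin (m + 1)) (J : Fin m → Fin n) =>
      ∑ σ : Equiv.Perm (Fin (m + 1)) with σ 0 = r, ∏ c : Fin m, A (σ c.succ) (J c) := by
    ext i J
    rw [hH, Matrix.permanent, Matrix.mul_apply,
      ← Finset.sum_fiberwise (s := Finset.univ) (g := fun σ : Equiv.Perm (Fin (m + 1)) => σ 0)]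
    refine Finset.sum_congr rfl fun r _ => ?_
    rw [Matrix.of_apply, Finset.mul_sum]
    refine Finset.sum_congr rfl fun σ hσ => ?_
    rw [Fin.prod_univ_succ]
    simp [← (Finset.mem_filter.mp hσ).2]
  rw [hfactor]
  exact (Matrix.rank_mul_le_left _ _).trans (Matrix.rank_le_width _)
end

section
/- Let k be a field with char k ≠ 2, let d and n be integers with d < n < 2d-1, and let I_d(d,n) be the ideal of d×d subpermanents of the generic d×n matrix M = (x_{i,j}) in k[x_{i,j}]. For a (d-1)-element subset ᾱ ⊆ {1, …, n}, let A_ᾱ be the permanent of the (d-1)×(d-1) submatrix of M with rows 2, …, d and columns ᾱ, and set A'_ᾱ = A_ᾱ · ∏_{i ∉ ᾱ} x_{1,i}; for 0 ≤ i ≤ d-1, set T_i(ᾱ) = ∑ A'_{ᾱ'}, the sum over all (d-1)-element subsets ᾱ' ⊆ {1, …, n} with |ᾱ' ∩ ᾱ| = i. Then for every (d-1)-element subset ᾱ, the element (n-d+1)! · (A'_ᾱ + (-1)^{n-d} T_{2d-n-2}(ᾱ)) lies in I_d(d,n). -/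
open MvPolynomial

/-- `A'_ᾱ`: the permanent of the `(d-1) × (d-1)` submatrix of the generic `d × n` matrix
with rows `2, …, d` and columns `ᾱ`, multiplied by `∏_{i ∉ ᾱ} x_{1,i}`
(and `0` if `ᾱ` does not have `d - 1` elements). -/
noncomputable def Aprime (k : Type*) [Field k] (d n : ℕ) (hd : 0 < d) (α : Finset (Fin n)) :
    MvPolynomial (Fin d × Fin n) k :=
  if h : α.card = d - 1 then
    Matrix.permanent (Matrix.of fun (i j : Fin (d - 1)) =>
      X ((⟨(i : ℕ) + 1, by have := i.isLt; omega⟩ : Fin d), (α.orderIsoOfFin h j : Fin n))) *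
    ∏ i ∈ αᶜ, X ((⟨0, hd⟩ : Fin d), i)
  else 0

/-- `T_i(ᾱ) = ∑ A'_{ᾱ'}`, summing over all `(d-1)`-element subsets `ᾱ'` of the columns
with `|ᾱ' ∩ ᾱ| = i`. -/
noncomputable def Tsum (k : Type*) [Field k] (d n : ℕ) (hd : 0 < d) (α : Finset (Fin n))
    (i : ℕ) : MvPolynomial (Fin d × Fin n) k :=
  ∑ β ∈ Finset.univ.filter (fun β : Finset (Fin n) => β.card = d - 1 ∧ (β ∩ α).card = i),
    Aprime k d n hd β

/-- The permanent of the square matrix with columns `c`, as a sum over all maps from the rows onto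
the set of columns. -/
theorem permanent_of_comp_eq_sum {R N : Type*} [CommRing R] [Fintype N] [DecidableEq N] {d : ℕ}
    (a : Fin d → N → R) (c : Fin d → N) (hc : Function.Injective c) (γ : Finset N)
    (hγ : Finset.univ.image c = γ) :
    Matrix.permanent (Matrix.of fun i j => a i (c j)) =
      ∑ f ∈ Finset.univ.filter (fun f : Fin d → N => Finset.univ.image f = γ),
        ∏ i, a i (f i) := by
  subst hγ
  rw [← Matrix.permanent_transpose, Matrix.permanent]
  refine Finset.sum_bij (fun σ _ => c ∘ σ) ?_ ?_ ?_ ?_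
  · intro σ _
    simp only [Finset.mem_filter, Finset.mem_univ, true_and]
    rw [← Finset.image_image, Finset.image_univ_equiv]
  · intro σ _ τ _ h
    ext1 i
    exact hc (congrFun h i)
  · intro f hf
    simp only [Finset.mem_filter, Finset.mem_univ, true_and] at hf
    have hmem : ∀ i, ∃ j, c j = f i := fun i => by
      have : f i ∈ Finset.univ.image c := hf ▸ Finset.mem_image_of_mem f (Finset.mem_univ i)
      simpa using this
    choose σ hσ using hmem
    have hσ_surj : Function.Surjective σ := fun j => by
      have : c j ∈ Finset.univ.image f := hf ▸ Finset.mem_image_of_mem c (Finset.mem_univ j)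
      obtain ⟨i, -, hi⟩ := Finset.mem_image.1 this
      exact ⟨i, hc ((hσ i).trans hi)⟩
    exact ⟨Equiv.ofBijective σ (Finite.injective_iff_bijective.1
      (Finite.injective_iff_surjective.2 hσ_surj)), Finset.mem_univ _, funext hσ⟩
  · intro σ _
    simp

/-- Expansion along the first row of the sum over all maps from the rows onto `γ`. -/
theorem sum_image_eq_expand_first_row {R N : Type*} [CommRing R] [Fintype N] [DecidableEq N]
    {e : ℕ} (a : Fin (e + 1) → N → R) (γ : Finset N) (hγ : γ.card = e + 1) :
    ∑ f ∈ Finset.univ.filter (fun f : Fin (e + 1) → N => Finset.univ.image f = γ),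
        ∏ i, a i (f i) =
      ∑ x ∈ γ, a 0 x *
        ∑ g ∈ Finset.univ.filter (fun g : Fin e → N => Finset.univ.image g = γ.erase x),
          ∏ i, a i.succ (g i) := by
  have himage : ∀ f : Fin (e + 1) → N, Finset.univ.image f =
      insert (f 0) (Finset.univ.image (Fin.tail f)) := fun f => by
    ext y
    simp [Fin.exists_fin_succ, Fin.tail, eq_comm]
  simp_rw [Finset.mul_sum]
  rw [Finset.sum_sigma']
  refine Finset.sum_bij' (fun f _ => ⟨f 0, Fin.tail f⟩) (fun p _ => Fin.cons p.1 p.2)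
    ?_ ?_ ?_ ?_ ?_
  · intro f hf
    simp only [Finset.mem_filter, Finset.mem_univ, true_and, Finset.mem_sigma] at hf ⊢
    have h0 : f 0 ∈ γ := hf ▸ Finset.mem_image_of_mem f (Finset.mem_univ 0)
    refine ⟨h0, ?_⟩
    have hle : (Finset.univ.image (Fin.tail f)).card ≤ e :=
      Finset.card_image_le.trans (by simp)
    have hsub : γ.erase (f 0) ⊆ Finset.univ.image (Fin.tail f) := by
      rw [← hf, himage]
      exact Finset.erase_insert_subset _ _
    refine (Finset.eq_of_subset_of_card_le hsub ?_).symm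
    rw [Finset.card_erase_of_mem h0, hγ]
    exact hle
  · rintro ⟨x, g⟩ hp
    simp only [Finset.mem_filter, Finset.mem_univ, true_and, Finset.mem_sigma] at hp ⊢
    rw [himage, Fin.tail_cons, Fin.cons_zero, hp.2, Finset.insert_erase hp.1]
  · intro f _
    exact Fin.cons_self_tail f
  · rintro ⟨x, g⟩ _
    simp
  · intro f _
    rw [Fin.prod_univ_succ]
    rfl

/-- If the sum of `f` over the facets of every `(e + 1)`-set vanishes, then the sums of `f` over the
`e`-sets at consecutive distances from a fixed `e`-set `α` are proportional. -/
theorem sum_card_sdiff_recurrence {R N : Type*} [CommRing R] [Fintype N] [DecidableEq N]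
    {e : ℕ} (f : Finset N → R)
    (hf : ∀ γ : Finset N, γ.card = e + 1 → ∑ x ∈ γ, f (γ.erase x) = 0)
    (α : Finset N) (hα : α.card = e) (j : ℕ) :
    ((j + 1 : ℕ) : R) *
        ∑ β ∈ Finset.univ.filter (fun β : Finset N => β.card = e ∧ (β \ α).card = j + 1), f β +
      ((Fintype.card N - e - j : ℕ) : R) *
        ∑ β ∈ Finset.univ.filter (fun β : Finset N => β.card = e ∧ (β \ α).card = j), f β = 0 := by
  have hzero : ∑ γ ∈ Finset.univ.filter
      (fun γ : Finset N => γ.card = e + 1 ∧ (γ \ α).card = j + 1),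
      ∑ x ∈ γ, f (γ.erase x) = 0 :=
    Finset.sum_eq_zero fun γ hγ => hf γ (Finset.mem_filter.1 hγ).2.1
  have hswap : ∑ γ ∈ Finset.univ.filter
        (fun γ : Finset N => γ.card = e + 1 ∧ (γ \ α).card = j + 1),
        ∑ x ∈ γ, f (γ.erase x) =
      ∑ β ∈ Finset.univ.filter (fun β : Finset N => β.card = e),
        ∑ _x ∈ βᶜ.filter (fun x => (insert x β \ α).card = j + 1), f β := by
    rw [Finset.sum_sigma', Finset.sum_sigma']
    refine Finset.sum_bij' (fun p _ => ⟨p.1.erase p.2, p.2⟩) (fun p _ => ⟨insert p.2 p.1, p.2⟩)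
      ?_ ?_ ?_ ?_ ?_
    · rintro ⟨γ, x⟩ h
      simp only [Finset.mem_sigma, Finset.mem_filter, Finset.mem_univ, true_and] at h
      simp [Finset.insert_erase h.2, Finset.card_erase_of_mem h.2, h.1]
    · rintro ⟨β, x⟩ h
      simp only [Finset.mem_sigma, Finset.mem_filter, Finset.mem_univ, true_and,
        Finset.mem_compl] at h
      simp [Finset.card_insert_of_notMem h.2.1, h.1, h.2.2]
    · rintro ⟨γ, x⟩ h
      simp only [Finset.mem_sigma, Finset.mem_filter, Finset.mem_univ, true_and] at h
      simp [Finset.insert_erase h.2]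
    · rintro ⟨β, x⟩ h
      simp only [Finset.mem_sigma, Finset.mem_filter, Finset.mem_univ, true_and,
        Finset.mem_compl] at h
      simp [Finset.erase_insert h.2.1]
    · rintro ⟨γ, x⟩ _
      rfl
  have hcount : ∀ β : Finset N, β.card = e →
      (βᶜ.filter (fun x => (insert x β \ α).card = j + 1)).card =
        (if (β \ α).card = j + 1 then j + 1 else 0) +
        (if (β \ α).card = j then Fintype.card N - e - j else 0) := by
    intro β hβ
    have hin : ∀ x ∈ α, (insert x β \ α).card = (β \ α).card := fun x hx => by
      rw [Finset.insert_sdiff_of_mem _ hx]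
    have hout : ∀ x ∉ β, x ∉ α → (insert x β \ α).card = (β \ α).card + 1 := fun x hxβ hxα => by
      rw [Finset.insert_sdiff_of_notMem _ hxα, Finset.card_insert_of_notMem (by simp [hxβ])]
    have hsymm : (α \ β).card = (β \ α).card := Finset.card_sdiff_comm (hα.trans hβ.symm)
    have hunion : ((α ∪ β)ᶜ).card = Fintype.card N - e - (β \ α).card := by
      rw [Finset.card_compl, Finset.union_comm, ← Finset.card_sdiff_add_card, hα]
      omega
    rcases eq_or_ne (β \ α).card (j + 1) with h | h
    · rw [if_pos h, if_neg (by omega), add_zero, ← h, ← hsymm]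
      congr 1
      ext x
      simp only [Finset.mem_filter, Finset.mem_compl, Finset.mem_sdiff]
      by_cases hxα : x ∈ α
      · by_cases hxβ : x ∈ β <;> simp [hxα, hxβ, hsymm, hin x hxα]
      · by_cases hxβ : x ∈ β
        · simp [hxα, hxβ]
        · simp [hxα, hxβ, hsymm, hout x hxβ hxα]
    rcases eq_or_ne (β \ α).card j with h' | h'
    · rw [if_neg h, if_pos h', zero_add]
      rw [h'] at hunion
      rw [← hunion]
      congr 1
      ext x
      simp only [Finset.mem_filter, Finset.mem_compl, Finset.mem_union, not_or]
      by_cases hxα : x ∈ α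
      · simp [hxα, hin x hxα, h]
      · by_cases hxβ : x ∈ β
        · simp [hxα, hxβ]
        · simp [hxα, hxβ, h', hout x hxβ hxα]
    · rw [if_neg h, if_neg h', Finset.card_eq_zero, Finset.filter_eq_empty_iff]
      intro x hx
      rw [Finset.mem_compl] at hx
      by_cases hxα : x ∈ α
      · rwa [hin x hxα]
      · rw [hout x hx hxα]
        omega
  rw [← hzero, hswap, Finset.mul_sum, Finset.mul_sum, ← Finset.filter_filter,
    ← Finset.filter_filter, Finset.sum_filter (fun β : Finset N => (β \ α).card = j + 1),
    Finset.sum_filter (fun β : Finset N => (β \ α).card = j), ← Finset.sum_add_distrib]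
  refine Finset.sum_congr rfl fun β hβ => ?_
  rw [Finset.sum_const, hcount β (Finset.mem_filter.1 hβ).2, nsmul_eq_mul]
  split_ifs <;> push_cast <;> ring

theorem factorial_mul_sum_card_sdiff {R N : Type*} [CommRing R] [Fintype N] [DecidableEq N]
    {e : ℕ} (f : Finset N → R)
    (hf : ∀ γ : Finset N, γ.card = e + 1 → ∑ x ∈ γ, f (γ.erase x) = 0)
    (α : Finset N) (hα : α.card = e) (j : ℕ) :
    (j.factorial : R) *
        ∑ β ∈ Finset.univ.filter (fun β : Finset N => β.card = e ∧ (β \ α).card = j), f β =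
      (-1) ^ j * ((Fintype.card N - e).descFactorial j : R) * f α := by
  induction j with
  | zero =>
    have : Finset.univ.filter (fun β : Finset N => β.card = e ∧ (β \ α).card = 0) = {α} := by
      ext β
      simp only [Finset.mem_filter, Finset.mem_univ, true_and, Finset.card_eq_zero,
        Finset.sdiff_eq_empty_iff_subset, Finset.mem_singleton]
      constructor
      · rintro ⟨hβ, hsub⟩
        exact Finset.eq_of_subset_of_card_le hsub (by omega)
      · rintro rfl
        exact ⟨hα, subset_rfl⟩
    rw [this, Finset.sum_singleton]
    simp
  | succ j ih =>
    have hrec := sum_card_sdiff_recurrence f hf α hα j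
    rw [Nat.factorial_succ, Nat.descFactorial_succ]
    push_cast at hrec ⊢
    linear_combination (j.factorial : R) * hrec - ((Fintype.card N - e - j : ℕ) : R) * ih

theorem mul_add_neg_one_pow_mul_eq_zero {R : Type*} [CommRing R] {c a t : R} {r : ℕ}
    (h : c * t = (-1) ^ (r + 1) * c * a) : c * (a + (-1) ^ r * t) = 0 := by
  have hsign : ((-1) ^ r * (-1) ^ r : R) = 1 := by
    rw [← mul_pow]
    simp
  rw [pow_succ] at h
  linear_combination (-1) ^ r * h - c * a * hsign

theorem Aprime_eq_sum (k : Type*) [Field k] (e n : ℕ) (β : Finset (Fin n)) (hβ : β.card = e) :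
    Aprime k (e + 1) n e.succ_pos β =
      (∑ g ∈ Finset.univ.filter (fun g : Fin e → Fin n => Finset.univ.image g = β),
        ∏ i, X ((i.succ : Fin (e + 1)), g i)) * ∏ i ∈ βᶜ, X ((0 : Fin (e + 1)), i) := by
  rw [Aprime, dif_pos (show β.card = e + 1 - 1 from hβ)]
  congr 1
  refine permanent_of_comp_eq_sum (fun (i : Fin e) (x : Fin n) =>
    (X ((i.succ : Fin (e + 1)), x) : MvPolynomial (Fin (e + 1) × Fin n) k))
    (β.orderEmbOfFin hβ) (β.orderEmbOfFin hβ).injective β ?_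
  exact Finset.image_orderEmbOfFin_univ β hβ

/-- The sum of `A'` over the facets of a set `γ` of `e + 1` columns is a multiple of the
subpermanent on the columns `γ`. -/
theorem sum_Aprime_erase_mem (k : Type*) [Field k] (e n : ℕ) (γ : Finset (Fin n))
    (hγ : γ.card = e + 1) :
    ∑ x ∈ γ, Aprime k (e + 1) n e.succ_pos (γ.erase x) ∈ permIdeal k (e + 1) (e + 1) n := by
  have hperm : Matrix.permanent (Matrix.of fun i j =>
      (X (i, γ.orderEmbOfFin hγ j) : MvPolynomial (Fin (e + 1) × Fin n) k)) ∈
      permIdeal k (e + 1) (e + 1) n :=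
    Ideal.subset_span ⟨id, γ.orderEmbOfFin hγ, strictMono_id,
      (γ.orderEmbOfFin hγ).strictMono, rfl⟩
  rw [permanent_of_comp_eq_sum (fun i x => X (i, x)) _ (γ.orderEmbOfFin hγ).injective γ
    (Finset.image_orderEmbOfFin_univ γ hγ), sum_image_eq_expand_first_row (fun i x => X (i, x)) γ hγ] at hperm
  convert Ideal.mul_mem_right (∏ i ∈ γᶜ, X ((0 : Fin (e + 1)), i)) _ hperm using 1
  rw [Finset.sum_mul]
  refine Finset.sum_congr rfl fun x hx => ?_
  rw [Aprime_eq_sum k e n _ (by rw [Finset.card_erase_of_mem hx, hγ]; rfl),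
    Finset.compl_erase, Finset.prod_insert (by simpa using hx)]
  ring

theorem stmt3 (k : Type*) [Field k] (hchar : ringChar k ≠ 2) (d n : ℕ)
    (hdn : d < n) (hn : n < 2 * d - 1) (hd : 0 < d)
    (α : Finset (Fin n)) (hα : α.card = d - 1) :
    ((n - d + 1).factorial : MvPolynomial (Fin d × Fin n) k) *
        (Aprime k d n hd α + (-1) ^ (n - d) * Tsum k d n hd α (2 * d - n - 2)) ∈
      permIdeal k d d n := by
  obtain ⟨e, rfl⟩ : ∃ e, d = e + 1 := ⟨d - 1, by omega⟩
  rw [Nat.add_sub_cancel] at hα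
  set π := Ideal.Quotient.mk (permIdeal k (e + 1) (e + 1) n) with hπ
  have key := factorial_mul_sum_card_sdiff (fun β => π (Aprime k (e + 1) n hd β))
    (fun γ hγ => by
      rw [← map_sum]
      exact Ideal.Quotient.eq_zero_iff_mem.2 (sum_Aprime_erase_mem k e n γ hγ))
    α hα (n - (e + 1) + 1)
  have hcard : Fintype.card (Fin n) - e = n - (e + 1) + 1 := by
    rw [Fintype.card_fin]
    omega
  have hT : Tsum k (e + 1) n hd α (2 * (e + 1) - n - 2) =
      ∑ β ∈ Finset.univ.filter
        (fun β : Finset (Fin n) => β.card = e ∧ (β \ α).card = n - (e + 1) + 1),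
        Aprime k (e + 1) n hd β := by
    refine Finset.sum_congr (Finset.filter_congr fun β _ => and_congr_right fun hβ => ?_)
      fun _ _ => rfl
    have := Finset.card_sdiff_add_card_inter β α
    omega
  rw [hcard, Nat.descFactorial_self, ← map_sum, ← hT] at key
  rw [← Ideal.Quotient.eq_zero_iff_mem, ← hπ]
  simp only [map_mul, map_add, map_pow, map_neg, map_one, map_natCast]
  exact mul_add_neg_one_pow_mul_eq_zero key
end

section
/- Let k be a field, let d ≥ 1, and let I_d(d,2d-1) be the ideal of d×d subpermanents of the generic d×(2d-1) matrix M = (x_{i,j}) in k[x_{i,j} : 1 ≤ i ≤ d, 1 ≤ j ≤ 2d-1]. For a (d-1)-element subset ᾱ ⊆ {1, …, 2d-1}, let A_ᾱ be the permanent of the (d-1)×(d-1) submatrix of M with rows 2, …, d and columns ᾱ, and set A'_ᾱ = A_ᾱ · ∏_{i ∉ ᾱ} x_{1,i}. Then for every such ᾱ, the element d! · A'_ᾱ lies in I_d(d,2d-1). -/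
open MvPolynomial

section SubpermanentAux

open Finset

variable {ι R : Type*} [Fintype ι] [DecidableEq ι] [CommRing R]

/-- The permanent of the columns `γ` of an `m`-row matrix `x` (for `γ` with `m` elements), as a
sum over the maps from the rows onto `γ`. -/
def colPerm {m : ℕ} (x : Fin m → ι → R) (γ : Finset ι) : R :=
  ∑ f : Fin m → ι, if univ.image f = γ then ∏ i, x i (f i) else 0

theorem permanent_eq_colPerm {m : ℕ} (x : Fin m → ι → R) (c : Fin m → ι)
    (hc : Function.Injective c) :
    Matrix.permanent (Matrix.of fun i j => x i (c j)) = colPerm x (univ.image c) := by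
  rw [← Matrix.permanent_transpose, colPerm, ← sum_filter, Matrix.permanent]
  refine sum_bij (fun σ _ i => c (σ i)) ?_ ?_ ?_ ?_
  · intro σ _
    simp only [mem_filter, mem_univ, true_and]
    ext a
    simp only [mem_image, mem_univ, true_and]
    exact ⟨fun ⟨i, hi⟩ => ⟨σ i, hi⟩, fun ⟨i, hi⟩ => ⟨σ.symm i, by simpa using hi⟩⟩
  · intro σ _ τ _ h
    ext i
    exact congrArg _ (hc (congrFun h i))
  · intro f hf
    simp only [mem_filter, mem_univ, true_and] at hf
    have hinj : Function.Injective f := by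
      rw [← Set.injOn_univ, ← coe_univ, ← card_image_iff, hf, card_image_of_injective _ hc]
    have hex : ∀ i, ∃ j, c j = f i := fun i => by
      have : f i ∈ univ.image c := hf ▸ mem_image_of_mem f (mem_univ i)
      simpa using this
    choose σ hσ using hex
    have hσi : Function.Injective σ := fun a b h => hinj (by rw [← hσ, ← hσ, h])
    exact ⟨Equiv.ofBijective σ (Finite.injective_iff_bijective.mp hσi), mem_univ _,
      funext hσ⟩
  · intro σ _
    simp

theorem colPerm_succ {m : ℕ} (x : Fin (m + 1) → ι → R) (β : Finset ι) (hβ : #β = m + 1) :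
    colPerm x β = ∑ i ∈ β, x 0 i * colPerm (fun j => x j.succ) (β.erase i) := by
  have himage (i : ι) (g : Fin m → ι) :
      univ.image (Fin.cons i g : Fin (m + 1) → ι) = β ↔ i ∈ β ∧ univ.image g = β.erase i := by
    have h0 : univ.image (Fin.cons i g : Fin (m + 1) → ι) = insert i (univ.image g) := by
      ext a
      simp [Fin.exists_fin_succ, eq_comm]
    have hcard : #(univ.image g) ≤ m := card_image_le.trans (by simp)
    rw [h0]
    constructor
    · rintro rfl
      have : i ∉ univ.image g := fun hi => by
        rw [insert_eq_of_mem hi] at hβ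
        omega
      exact ⟨mem_insert_self _ _, (erase_insert this).symm⟩
    · rintro ⟨hi, h⟩
      rw [h, insert_erase hi]
  rw [colPerm, ← (Fin.consEquiv fun _ => ι).sum_comp, Fintype.sum_prod_type,
    ← sum_subset (subset_univ β)]
  · refine sum_congr rfl fun i hi => ?_
    rw [colPerm, mul_sum]
    refine sum_congr rfl fun g _ => ?_
    change (if univ.image (Fin.cons i g : Fin (m + 1) → ι) = β then
      ∏ j, x j ((Fin.cons i g : Fin (m + 1) → ι) j) else 0) = _
    simp only [himage, hi, true_and, Fin.prod_univ_succ, Fin.cons_zero,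
      Fin.cons_succ, mul_ite, mul_zero]
  · intro i _ hi
    refine sum_eq_zero fun g _ => ?_
    exact if_neg fun h => hi ((himage i g).mp h).1

/-- Over a set of size `2 * t + 1`, the coefficients of the inverse of the inclusion matrix
between `t`-subsets and `(t + 1)`-subsets, up to the factor `(t + 1)!`. -/
def inclusionCoeff (t j : ℕ) : ℤ :=
  (-1) ^ (t - j) * (j.factorial * (t - j).factorial : ℕ)

theorem inclusionCoeff_recurrence {t j : ℕ} (h : j < t) :
    ((t - j : ℕ) : ℤ) * inclusionCoeff t (j + 1) + (j + 1) * inclusionCoeff t j = 0 := by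
  obtain ⟨s, rfl⟩ := Nat.exists_eq_add_of_lt h
  have h1 : j + s + 1 - j = s + 1 := by omega
  have h2 : j + s + 1 - (j + 1) = s := by omega
  rw [inclusionCoeff, inclusionCoeff, h1, h2, Nat.factorial_succ, Nat.factorial_succ]
  push_cast
  ring

theorem sum_compl_inclusionCoeff {t : ℕ} (hι : Fintype.card ι = 2 * t + 1) {α γ : Finset ι}
    (hα : #α = t) (hγ : #γ = t) :
    ∑ i ∈ γᶜ, inclusionCoeff t #(α ∩ insert i γ) =
      if γ = α then ((t + 1).factorial : ℤ) else 0 := by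
  have hterm : ∀ i ∈ γᶜ, inclusionCoeff t #(α ∩ insert i γ) =
      if i ∈ α then inclusionCoeff t (#(α ∩ γ) + 1) else inclusionCoeff t #(α ∩ γ) := by
    intro i hi
    split_ifs with h
    · rw [inter_insert_of_mem h, card_insert_of_notMem]
      simp only [mem_compl] at hi
      simp [hi]
    · rw [inter_insert_of_notMem h]
  have hin : #{i ∈ γᶜ | i ∈ α} = t - #(α ∩ γ) := by
    rw [show ({i ∈ γᶜ | i ∈ α} : Finset ι) = α \ γ by ext; simp [and_comm], card_sdiff,
      hα, inter_comm]
  have hout : #{i ∈ γᶜ | i ∉ α} = #(α ∩ γ) + 1 := by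
    have h1 := card_filter_add_card_filter_not (s := γᶜ) (fun i => i ∈ α)
    have h2 : #(α ∩ γ) ≤ t := hα ▸ card_le_card inter_subset_left
    rw [hin, card_compl, hι, hγ] at h1
    omega
  rw [sum_congr rfl hterm, sum_ite, sum_const, sum_const, hin, hout, nsmul_eq_mul, nsmul_eq_mul]
  split_ifs with h
  · subst h
    simp [inclusionCoeff, hγ, Nat.factorial_succ]
  · have hlt : #(α ∩ γ) < t := by
      refine lt_of_le_of_ne (hα ▸ card_le_card inter_subset_left) fun heq => h ?_
      have hαγ : α ∩ γ = α := eq_of_subset_of_card_le inter_subset_left (by omega)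
      exact (eq_of_subset_of_card_le (inter_eq_left.mp hαγ) (by omega)).symm
    exact_mod_cast inclusionCoeff_recurrence hlt

theorem factorial_mul_eq_sum_inclusionCoeff {t : ℕ} (hι : Fintype.card ι = 2 * t + 1)
    {α : Finset ι} (hα : #α = t) (a : Finset ι → R) :
    ((t + 1).factorial : R) * a α = ∑ β ∈ powersetCard (t + 1) univ,
      (inclusionCoeff t #(α ∩ β) : R) * ∑ i ∈ β, a (β.erase i) := by
  have hswap : ∑ β ∈ powersetCard (t + 1) univ,
      (inclusionCoeff t #(α ∩ β) : R) * ∑ i ∈ β, a (β.erase i) =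
      ∑ γ ∈ powersetCard t univ, ∑ i ∈ γᶜ,
        (inclusionCoeff t #(α ∩ insert i γ) : R) * a γ := by
    simp_rw [mul_sum]
    rw [sum_sigma', sum_sigma']
    refine sum_bij' (fun p _ => ⟨p.1.erase p.2, p.2⟩) (fun p _ => ⟨insert p.2 p.1, p.2⟩)
      ?_ ?_ ?_ ?_ ?_
    · rintro ⟨β, i⟩ h
      simp only [mem_sigma, mem_powersetCard_univ] at h
      simp [card_erase_of_mem h.2, h.1]
    · rintro ⟨γ, i⟩ h
      simp only [mem_sigma, mem_powersetCard_univ, mem_compl] at h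
      simp [card_insert_of_notMem h.2, h.1]
    · rintro ⟨β, i⟩ h
      simp only [mem_sigma, mem_powersetCard_univ] at h
      simp [insert_erase h.2]
    · rintro ⟨γ, i⟩ h
      simp only [mem_sigma, mem_powersetCard_univ, mem_compl] at h
      simp [erase_insert h.2]
    · rintro ⟨β, i⟩ h
      simp only [mem_sigma, mem_powersetCard_univ] at h
      simp [insert_erase h.2]
  rw [hswap, sum_eq_single_of_mem α (by simpa using hα)]
  · rw [← sum_mul, ← Int.cast_sum, sum_compl_inclusionCoeff hι hα hα]
    simp
  · intro γ hγ hne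
    rw [← sum_mul, ← Int.cast_sum,
      sum_compl_inclusionCoeff hι hα (by simpa using hγ), if_neg hne]
    simp

end SubpermanentAux

theorem Aprime_eq_colPerm (k : Type*) [Field k] (t n : ℕ) (hd : 0 < t + 1) (γ : Finset (Fin n))
    (hγ : γ.card = t) :
    Aprime k (t + 1) n hd γ =
      colPerm (fun (i : Fin t) (j : Fin n) =>
        (X (i.succ, j) : MvPolynomial (Fin (t + 1) × Fin n) k)) γ *
      ∏ i ∈ γᶜ, X ((0 : Fin (t + 1)), i) := by
  rw [Aprime, dif_pos (show γ.card = t + 1 - 1 from hγ)]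
  have h := permanent_eq_colPerm (fun (i : Fin t) (j : Fin n) =>
    (X (i.succ, j) : MvPolynomial (Fin (t + 1) × Fin n) k)) (γ.orderEmbOfFin hγ)
    (γ.orderEmbOfFin hγ).injective
  rw [Finset.image_orderEmbOfFin_univ] at h
  rw [← h]
  rfl

theorem sum_Aprime_erase_mem_permIdeal (k : Type*) [Field k] (t n : ℕ) (hd : 0 < t + 1)
    (β : Finset (Fin n)) (hβ : β.card = t + 1) :
    ∑ i ∈ β, Aprime k (t + 1) n hd (β.erase i) ∈ permIdeal k (t + 1) (t + 1) n := by
  have hsum : ∑ i ∈ β, Aprime k (t + 1) n hd (β.erase i) =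
      (∏ i ∈ βᶜ, X ((0 : Fin (t + 1)), i)) *
        colPerm (fun i j => (X (i, j) : MvPolynomial (Fin (t + 1) × Fin n) k)) β := by
    rw [colPerm_succ _ _ hβ, Finset.mul_sum]
    refine Finset.sum_congr rfl fun i hi => ?_
    rw [Aprime_eq_colPerm _ _ _ _ _ (by rw [Finset.card_erase_of_mem hi, hβ]; rfl),
      Finset.compl_erase, Finset.prod_insert (by simpa using hi)]
    ring
  rw [hsum]
  refine Ideal.mul_mem_left _ _ (Ideal.subset_span
    ⟨id, β.orderEmbOfFin hβ, strictMono_id, (β.orderEmbOfFin hβ).strictMono, ?_⟩)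
  have h := permanent_eq_colPerm
    (fun i j => (X (i, j) : MvPolynomial (Fin (t + 1) × Fin n) k)) (β.orderEmbOfFin hβ)
    (β.orderEmbOfFin hβ).injective
  rw [Finset.image_orderEmbOfFin_univ] at h
  exact h.symm

theorem stmt4 (k : Type*) [Field k] (d : ℕ) (hd : 0 < d)
    (α : Finset (Fin (2 * d - 1))) (hα : α.card = d - 1) :
    (d.factorial : MvPolynomial (Fin d × Fin (2 * d - 1)) k) * Aprime k d (2 * d - 1) hd α ∈
      permIdeal k d d (2 * d - 1) := by
  obtain ⟨t, rfl⟩ := Nat.exists_eq_succ_of_ne_zero hd.ne'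
  rw [factorial_mul_eq_sum_inclusionCoeff (t := t) (by simp; omega) hα]
  exact Ideal.sum_mem _ fun β hβ => Ideal.mul_mem_left _ _
    (sum_Aprime_erase_mem_permIdeal k t _ hd β (Finset.mem_powersetCard_univ.mp hβ))
end

section
/- Let k be a field with char k = 0 or char k > d, and let I_d(d,2d-1) be the ideal of d×d subpermanents of the generic d×(2d-1) matrix (x_{i,j}) in k[x_{i,j} : 1 ≤ i ≤ d, 1 ≤ j ≤ 2d-1]. Then the product of all the variables, ∏_{i=1}^{d} ∏_{j=1}^{2d-1} x_{i,j}, lies in I_d(d,2d-1). -/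
open MvPolynomial

/-- The `d × d` subpermanent of `M` on the column set `S`, by expansion along the first row. -/
def subpermanent {α R : Type*} [DecidableEq α] [CommSemiring R] :
    (d : ℕ) → (Fin d → α → R) → Finset α → R
  | 0, _, _ => 1
  | d + 1, M, S => ∑ j ∈ S, M 0 j * subpermanent d (fun i => M i.succ) (S.erase j)

theorem subpermanent_image {α R : Type*} [DecidableEq α] [CommSemiring R] (d : ℕ)
    (M : Fin d → α → R) (c : Fin d → α) (hc : Function.Injective c) :
    subpermanent d M (Finset.univ.image c) =
      ∑ σ : Equiv.Perm (Fin d), ∏ i, M i (c (σ i)) := by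
  induction d with
  | zero => simp [subpermanent]
  | succ d ih =>
    rw [subpermanent, Finset.sum_image hc.injOn,
      ← Equiv.sum_comp Equiv.Perm.decomposeFin.symm, Fintype.sum_prod_type]
    refine Finset.sum_congr rfl fun p _ => ?_
    have hinj : Function.Injective fun i : Fin d => c (Equiv.swap 0 p i.succ) :=
      hc.comp ((Equiv.injective _).comp (Fin.succ_injective d))
    have himage : (Finset.univ.image c).erase (c p) =
        Finset.univ.image fun i : Fin d => c (Equiv.swap 0 p i.succ) := by
      ext x
      simp only [Finset.mem_erase, Finset.mem_image, Finset.mem_univ, true_and]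
      constructor
      · rintro ⟨hx, a, rfl⟩
        have hne : Equiv.swap 0 p a ≠ 0 := fun h => hx <| by
          rw [Equiv.swap_apply_eq_iff, Equiv.swap_apply_left] at h
          rw [h]
        obtain ⟨i, hi⟩ := Fin.exists_succ_eq.2 hne
        exact ⟨i, by rw [hi, Equiv.swap_apply_self]⟩
      · rintro ⟨i, rfl⟩
        refine ⟨fun h => ?_, _, rfl⟩
        have h' := hc h
        rw [Equiv.swap_apply_eq_iff, Equiv.swap_apply_right] at h'
        exact Fin.succ_ne_zero i h'
    rw [himage, ih _ _ hinj, Finset.mul_sum]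
    refine Finset.sum_congr rfl fun σ _ => ?_
    simp [Fin.prod_univ_succ]

/-- Coefficients inverting the inclusion matrix between the `d`-subsets and the `(d + 1)`-subsets
of a set with `2 * d + 1` elements. -/
theorem exists_inclusion_coeff {k : Type*} [Field k] (d : ℕ)
    (hd : ∀ n : ℕ, 0 < n → n ≤ d + 1 → (n : k) ≠ 0) :
    ∃ c : ℕ → k, (d + 1 : k) * c d = 1 ∧
      ∀ i j : ℕ, i + 1 + j = d → (i + 1 : k) * c (j + 1) + (j + 1 : k) * c j = 0 := by
  let b : ℕ → k := fun n =>
    Nat.rec ((d + 1 : k)⁻¹) (fun i r => -((i + 1 : k) / ((d - i : ℕ) : k)) * r) n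
  refine ⟨fun j => b (d - j), ?_, fun i j hij => ?_⟩
  · have h := hd (d + 1) (by omega) le_rfl
    push_cast at h
    simpa [b] using mul_inv_cancel₀ h
  · have h := hd (j + 1) (by omega) (by omega)
    have h1 : d - (j + 1) = i := by omega
    have h2 : d - j = i + 1 := by omega
    have h3 : d - i = j + 1 := by omega
    have hb : b (i + 1) = -((i + 1 : k) / ((d - i : ℕ) : k)) * b i := rfl
    simp only [h1, h2, hb, h3]
    push_cast at h ⊢
    field_simp
    ring

theorem sum_powersetCard_sum_erase {α β : Type*} [DecidableEq α] [AddCommMonoid β]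
    (U : Finset α) (d : ℕ) (F : Finset α → Finset α → β) :
    ∑ S ∈ U.powersetCard (d + 1), ∑ j ∈ S, F S (S.erase j) =
      ∑ T ∈ U.powersetCard d, ∑ j ∈ U \ T, F (insert j T) T := by
  rw [Finset.sum_sigma', Finset.sum_sigma']
  refine Finset.sum_bij' (fun x _ => ⟨x.1.erase x.2, x.2⟩) (fun x _ => ⟨insert x.2 x.1, x.2⟩)
    ?_ ?_ ?_ ?_ ?_
  · rintro ⟨S, j⟩ h
    simp only [Finset.mem_sigma, Finset.mem_powersetCard, Finset.mem_sdiff] at h ⊢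
    obtain ⟨⟨hSU, hS⟩, hj⟩ := h
    exact ⟨⟨(Finset.erase_subset _ _).trans hSU, by rw [Finset.card_erase_of_mem hj]; omega⟩,
      hSU hj, Finset.notMem_erase _ _⟩
  · rintro ⟨T, j⟩ h
    simp only [Finset.mem_sigma, Finset.mem_powersetCard, Finset.mem_sdiff] at h ⊢
    obtain ⟨⟨hTU, hT⟩, hjU, hj⟩ := h
    exact ⟨⟨Finset.insert_subset hjU hTU, by rw [Finset.card_insert_of_notMem hj, hT]⟩,
      Finset.mem_insert_self _ _⟩
  · rintro ⟨S, j⟩ h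
    simp only [Finset.mem_sigma] at h
    simp [Finset.insert_erase h.2]
  · rintro ⟨T, j⟩ h
    simp only [Finset.mem_sigma, Finset.mem_sdiff] at h
    simp [Finset.erase_insert h.2.2]
  · rintro ⟨S, j⟩ h
    simp only [Finset.mem_sigma] at h
    simp [Finset.insert_erase h.2]

theorem sum_sdiff_card_insert_inter {α k : Type*} [DecidableEq α] [CommSemiring k]
    {U T T' : Finset α} {d : ℕ} (hU : U.card = 2 * d + 1) (hTU : T ⊆ U) (hT : T.card = d)
    (hTU' : T' ⊆ U) (hT' : T'.card = d) (c : ℕ → k) :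
    ∑ j ∈ U \ T', c (insert j T' ∩ T).card =
      ((T \ T').card : k) * c ((T' ∩ T).card + 1) +
        ((T' ∩ T).card + 1 : k) * c (T' ∩ T).card := by
  have hsub : T \ T' ⊆ U \ T' := Finset.sdiff_subset_sdiff hTU subset_rfl
  rw [← Finset.sum_sdiff hsub, add_comm]
  have hcard : ((U \ T') \ (T \ T')).card = (T' ∩ T).card + 1 := by
    rw [Finset.card_sdiff_of_subset hsub, Finset.card_sdiff_of_subset hTU']
    have := Finset.card_sdiff_add_card_inter T T'
    rw [Finset.inter_comm] at this
    omega
  congr 1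
  · rw [← nsmul_eq_mul, ← Finset.sum_const]
    refine Finset.sum_congr rfl fun j hj => ?_
    rw [Finset.mem_sdiff] at hj
    rw [Finset.insert_inter_of_mem hj.1, Finset.card_insert_of_notMem (by simp [hj.2])]
  · rw [← Nat.cast_add_one, ← hcard, ← nsmul_eq_mul, ← Finset.sum_const]
    refine Finset.sum_congr rfl fun j hj => ?_
    simp only [Finset.mem_sdiff, not_and, not_not] at hj
    rw [Finset.insert_inter_of_notMem fun h => hj.1.2 (hj.2 h)]

/-- Any function on the `d`-subsets of a `(2 * d + 1)`-set is recovered linearly from its sums over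
the `d`-subsets of each `(d + 1)`-subset. -/
theorem exists_eq_sum_smul_sum_erase {α k R : Type*} [DecidableEq α] [Field k]
    [AddCommGroup R] [Module k R] {d : ℕ} (hd : ∀ n : ℕ, 0 < n → n ≤ d + 1 → (n : k) ≠ 0)
    {U T : Finset α} (hU : U.card = 2 * d + 1) (hTU : T ⊆ U) (hT : T.card = d)
    (m : Finset α → R) :
    ∃ w : Finset α → k,
      m T = ∑ S ∈ U.powersetCard (d + 1), w S • ∑ j ∈ S, m (S.erase j) := by
  obtain ⟨c, hc, hc'⟩ := exists_inclusion_coeff d hd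
  refine ⟨fun S => c (S ∩ T).card, ?_⟩
  simp only [Finset.smul_sum]
  rw [sum_powersetCard_sum_erase U d fun S T' => c (S ∩ T).card • m T',
    Finset.sum_eq_single_of_mem T (Finset.mem_powersetCard.2 ⟨hTU, hT⟩)]
  · rw [← Finset.sum_smul, sum_sdiff_card_insert_inter hU hTU hT hTU hT]
    simp [hT, hc]
  · intro T' hT' hne
    rw [Finset.mem_powersetCard] at hT'
    rw [← Finset.sum_smul, sum_sdiff_card_insert_inter hU hTU hT hT'.1 hT'.2]
    have hpos : (T \ T').card ≠ 0 := by
      rw [Finset.card_ne_zero, Finset.sdiff_nonempty]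
      exact fun h => hne (Finset.eq_of_subset_of_card_le h (by omega)).symm
    obtain ⟨i, hi⟩ := Nat.exists_eq_succ_of_ne_zero hpos
    have hadd := Finset.card_sdiff_add_card_inter T T'
    rw [Finset.inter_comm] at hadd
    have := hc' i (T' ∩ T).card (by omega)
    rw [hi, Nat.succ_eq_add_one, Nat.cast_add_one, this, zero_smul]

theorem prod_sdiff_mul_subpermanent_mem {α k R : Type*} [DecidableEq α] [Field k] [CommRing R]
    [Algebra k R] {d : ℕ} (hd : ∀ n : ℕ, 0 < n → n ≤ d + 1 → (n : k) ≠ 0)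
    (M : Fin (d + 1) → α → R) {I : Ideal R} {U T : Finset α} (hU : U.card = 2 * d + 1)
    (hI : ∀ S ⊆ U, S.card = d + 1 → subpermanent (d + 1) M S ∈ I)
    (hTU : T ⊆ U) (hT : T.card = d) :
    (∏ j ∈ U \ T, M 0 j) * subpermanent d (fun i => M i.succ) T ∈ I := by
  obtain ⟨w, hw⟩ := exists_eq_sum_smul_sum_erase hd hU hTU hT
    fun T => (∏ j ∈ U \ T, M 0 j) * subpermanent d (fun i => M i.succ) T
  rw [hw]
  refine Ideal.sum_mem _ fun S hS => ?_
  rw [Finset.mem_powersetCard] at hS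
  have hexp : ∑ j ∈ S, (∏ l ∈ U \ S.erase j, M 0 l) *
      subpermanent d (fun i => M i.succ) (S.erase j) =
      (∏ l ∈ U \ S, M 0 l) * subpermanent (d + 1) M S := by
    rw [subpermanent, Finset.mul_sum]
    refine Finset.sum_congr rfl fun j hj => ?_
    rw [Finset.sdiff_erase (hS.1 hj), Finset.prod_insert (by simp [hj])]
    ring
  rw [hexp]
  exact Submodule.smul_of_tower_mem I _ (I.mul_mem_left _ (hI S hS.1 hS.2))

theorem prod_prod_mem_of_subpermanent_mem {α k R : Type*} [DecidableEq α] [Field k] [CommRing R]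
    [Algebra k R] (d : ℕ) (hd : ∀ n : ℕ, 0 < n → n ≤ d → (n : k) ≠ 0)
    (M : Fin d → α → R) (I : Ideal R) (U : Finset α) (hU : U.card = 2 * d - 1)
    (hI : ∀ S ⊆ U, S.card = d → subpermanent d M S ∈ I) :
    ∏ i, ∏ j ∈ U, M i j ∈ I := by
  induction d generalizing I U with
  | zero => simpa [subpermanent] using hI ∅ (by simp) rfl
  | succ d ih =>
    obtain ⟨V, hVU, hV⟩ := Finset.exists_subset_card_eq (s := U) (n := 2 * d - 1) (by omega)
    let p := ∏ j ∈ U, M 0 j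
    have key := ih (fun n h0 hn => hd n h0 (by omega)) (fun i => M i.succ)
      (Submodule.comap (LinearMap.mulLeft R p) I) V hV fun T hT hTd => by
        have hTU := hT.trans hVU
        have := prod_sdiff_mul_subpermanent_mem hd M (by omega) hI hTU hTd
        simp only [Submodule.mem_comap, LinearMap.mulLeft_apply, p]
        rw [← Finset.prod_sdiff hTU, mul_comm (∏ j ∈ U \ T, M 0 j), mul_assoc]
        exact I.mul_mem_left _ this
    rw [Submodule.mem_comap, LinearMap.mulLeft_apply] at key
    rw [Fin.prod_univ_succ]
    have hfac : ∏ i : Fin d, ∏ j ∈ U, M i.succ j =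
        (∏ i : Fin d, ∏ j ∈ U \ V, M i.succ j) * ∏ i : Fin d, ∏ j ∈ V, M i.succ j := by
      rw [← Finset.prod_mul_distrib]
      exact Finset.prod_congr rfl fun i _ => (Finset.prod_sdiff hVU).symm
    rw [hfac, mul_left_comm]
    exact I.mul_mem_left _ key

theorem subpermanent_X_mem_permIdeal (k : Type*) [Field k] (d n : ℕ) {S : Finset (Fin n)}
    (hS : S.card = d) :
    subpermanent d (fun i j => (X (i, j) : MvPolynomial (Fin d × Fin n) k)) S ∈
      permIdeal k d d n := by
  refine Ideal.subset_span ⟨id, S.orderEmbOfFin hS, strictMono_id,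
    (S.orderEmbOfFin hS).strictMono, ?_⟩
  have h := subpermanent_image d (fun i j => (X (i, j) : MvPolynomial (Fin d × Fin n) k))
    (S.orderEmbOfFin hS) (S.orderEmbOfFin hS).injective
  rw [Finset.image_orderEmbOfFin_univ] at h
  rw [h, ← Matrix.permanent_transpose]
  rfl

theorem stmt5 (k : Type*) [Field k] (d : ℕ)
    (hchar : ringChar k = 0 ∨ d < ringChar k) :
    (∏ i : Fin d, ∏ j : Fin (2 * d - 1), X (i, j)) ∈
      permIdeal k d d (2 * d - 1) := by
  have hd : ∀ n : ℕ, 0 < n → n ≤ d → (n : k) ≠ 0 := fun n h0 hn h => by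
    have hdvd := (ringChar.spec k n).1 h
    rcases hchar with hk | hk
    · rw [hk, zero_dvd_iff] at hdvd
      omega
    · exact absurd (Nat.le_of_dvd h0 hdvd) (by omega)
  exact prod_prod_mem_of_subpermanent_mem d hd _ _ Finset.univ (by simp)
    fun S _ hS => subpermanent_X_mem_permIdeal k d _ hS
end

section
/- Let k be a field with char k = 0 or char k > d, and let M be a d×(2d-1) matrix over k all of whose d×d subpermanents vanish. Then for every row index r ∈ {1, …, d}, either some entry in row r of M is 0, or all (d-1)×(d-1) subpermanents of the (d-1)×(2d-1) matrix obtained from M by deleting row r vanish. -/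
open Finset in
/-- The inclusion matrix between the `m`-subsets and the `(m + 1)`-subsets of a set with
`2 * m + 1` elements is injective over a field in which `1, …, m + 1` are invertible. -/
theorem eq_zero_of_sum_erase_eq_zero {κ K : Type*} [Fintype κ] [DecidableEq κ] [Field K] {m : ℕ}
    (hκ : Fintype.card κ = 2 * m + 1) (hK : ∀ i ≤ m, ((i + 1 : ℕ) : K) ≠ 0) (Q : Finset κ → K)
    (hQ : ∀ T : Finset κ, #T = m + 1 → ∑ j ∈ T, Q (T.erase j) = 0)
    {S : Finset κ} (hS : #S = m) : Q S = 0 := by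
  -- Double counting of the pairs `(U, insert j U)` such that `insert j U` meets `S` in `i` elements.
  have hswap (i : ℕ) : ∑ U ∈ powersetCard m univ, ∑ j ∈ Uᶜ,
      (if #(insert j U ∩ S) = i then Q U else 0) = 0 := by
    calc
      _ = ∑ T ∈ powersetCard (m + 1) univ, ∑ j ∈ T,
          (if #(T ∩ S) = i then Q (T.erase j) else 0) := by
        rw [sum_sigma', sum_sigma']
        refine sum_nbij' (fun p => ⟨insert p.2 p.1, p.2⟩) (fun p => ⟨p.1.erase p.2, p.2⟩)
          ?_ ?_ ?_ ?_ ?_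
        · rintro ⟨U, j⟩ h
          simp_all
        · rintro ⟨T, j⟩ h
          simp_all
        · rintro ⟨U, j⟩ h
          simp_all
        · rintro ⟨T, j⟩ h
          simp_all
        · rintro ⟨U, j⟩ h
          simp_all
      _ = 0 := by
        refine sum_eq_zero fun T hT => ?_
        split_ifs
        · exact hQ T (by simpa using hT)
        · simp
  have hinner (U : Finset κ) (hU : #U = m) (i : ℕ) :
      ∑ j ∈ Uᶜ, (if #(insert j U ∩ S) = i then Q U else 0) =
        ((i + 1 : ℕ) : K) * (if #(U ∩ S) = i then Q U else 0) +
          ((m + 1 - i : ℕ) : K) * (if #(U ∩ S) + 1 = i then Q U else 0) := by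
    rw [← sum_filter_add_sum_filter_not Uᶜ (· ∉ S)]
    have hle := card_union_add_card_inter U S
    have hsd := card_sdiff_add_card_inter S U
    rw [inter_comm S U] at hsd
    congr 1
    · have hcard : #{j ∈ Uᶜ | j ∉ S} = #(U ∩ S) + 1 := by
        have : {j ∈ Uᶜ | j ∉ S} = (U ∪ S)ᶜ := by ext; simp
        rw [this, card_compl]
        omega
      rw [sum_congr rfl (g := fun _ => if #(U ∩ S) = i then Q U else 0), sum_const, hcard,
        nsmul_eq_mul]
      · split_ifs with h
        · rw [h]
        · simp
      · intro j hj
        rw [insert_inter_of_notMem (by simp_all)]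
    · have hcard : #{j ∈ Uᶜ | ¬ j ∉ S} = m - #(U ∩ S) := by
        have : {j ∈ Uᶜ | ¬ j ∉ S} = S \ U := by ext; simp [and_comm]
        rw [this]
        omega
      rw [sum_congr rfl (g := fun _ => if #(U ∩ S) + 1 = i then Q U else 0), sum_const, hcard,
        nsmul_eq_mul]
      · split_ifs with h
        · rw [← h, Nat.add_sub_add_right]
        · simp
      · intro j hj
        simp only [mem_filter, mem_compl, not_not] at hj
        rw [insert_inter_of_mem hj.2, card_insert_of_notMem (by simp [hj.1])]
  have hlevel : ∀ i ≤ m, ∑ U ∈ powersetCard m univ, (if #(U ∩ S) = i then Q U else 0) = 0 := by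
    have hrec (i : ℕ) := hswap i
    simp_rw [sum_congr rfl fun U hU => hinner U (mem_powersetCard.1 hU).2 _, sum_add_distrib,
      ← mul_sum] at hrec
    intro i
    induction i with
    | zero => simpa using hrec 0
    | succ i ih =>
      intro hi
      have := hrec (i + 1)
      simp only [Nat.add_right_cancel_iff] at this
      rw [ih (by omega), mul_zero, add_zero] at this
      exact (mul_eq_zero.1 this).resolve_left (hK _ hi)
  rw [← hlevel m le_rfl, sum_eq_single_of_mem S (by simp [hS])]
  · simp [hS]
  · intro U hU hne
    refine if_neg fun h => hne ?_
    have hUm := (mem_powersetCard.1 hU).2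
    have h₁ : U ∩ S = U := eq_of_subset_of_card_le inter_subset_left (by omega)
    have h₂ : U ∩ S = S := eq_of_subset_of_card_le inter_subset_right (by omega)
    exact h₁.symm.trans h₂

namespace Matrix

variable {ι κ R : Type*} [Fintype ι] [DecidableEq ι] [Fintype κ] [DecidableEq κ] [CommRing R]

/-- The permanent of `M` on the set of columns `T`, as a sum over the maps from the rows
onto `T`. -/
def permanentOn (M : Matrix ι κ R) (T : Finset κ) : R :=
  ∑ f : ι → κ with Finset.univ.image f = T, ∏ i, M i (f i)

theorem permanentOn_image (M : Matrix ι κ R) {c : ι → κ} (hc : Function.Injective c) :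
    M.permanentOn (Finset.univ.image c) = permanent (of fun i j => M i (c j)) := by
  rw [← permanent_transpose, permanent, permanentOn]
  symm
  refine Finset.sum_bij (fun σ _ => c ∘ σ) ?_ ?_ ?_ ?_
  · intro σ _
    simp [← Finset.image_image]
  · intro σ _ τ _ h
    exact Equiv.ext fun i => hc (congrFun h i)
  · intro f hf
    have hf : Finset.univ.image f = Finset.univ.image c := by simpa using hf
    have hmem (i : ι) : ∃ j, c j = f i := by
      have : f i ∈ Finset.univ.image c := hf ▸ Finset.mem_image_of_mem f (Finset.mem_univ i)
      simpa using this
    choose σ hσ using hmem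
    have hfi : Function.Injective f := by
      rw [← Set.injOn_univ, ← Finset.coe_univ, ← Finset.card_image_iff, hf,
        Finset.card_image_of_injective _ hc]
    have hσi : Function.Injective σ := fun i j h => hfi (by rw [← hσ, ← hσ, h])
    exact ⟨Equiv.ofBijective σ (Finite.injective_iff_bijective.1 hσi), Finset.mem_univ _,
      funext hσ⟩
  · intro σ _
    simp

/-- Laplace expansion of the permanent along the row `r`. -/
theorem permanentOn_eq_sum_erase (M : Matrix ι κ R) (r : ι) {T : Finset κ}
    (hT : T.card = Fintype.card ι) :
    M.permanentOn T =
      ∑ j ∈ T, M r j * (M.submatrix ((↑) : {i // i ≠ r} → ι) id).permanentOn (T.erase j) := by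
  simp_rw [permanentOn, Finset.mul_sum]
  rw [Finset.sum_sigma']
  refine Finset.sum_bij' (fun f _ => ⟨f r, fun i => f i⟩)
    (fun p _ => (Equiv.funSplitAt r κ).symm (p.1, p.2)) ?_ ?_ ?_ ?_ ?_
  · intro f hf
    have hf : Finset.univ.image f = T := by simpa using hf
    have hfi : Function.Injective f := by
      rw [← Set.injOn_univ, ← Finset.coe_univ, ← Finset.card_image_iff, hf, hT, Finset.card_univ]
    simp only [Finset.mem_sigma, Finset.mem_filter, Finset.mem_univ, true_and]
    subst hf
    refine ⟨by simp, ?_⟩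
    ext x
    simp only [Finset.mem_image, Finset.mem_univ, true_and, Finset.mem_erase, Subtype.exists]
    constructor
    · rintro ⟨i, hi, rfl⟩
      exact ⟨hfi.ne hi, i, rfl⟩
    · rintro ⟨hx, i, rfl⟩
      exact ⟨i, fun h => hx (h ▸ rfl), rfl⟩
  · rintro ⟨j, g⟩ hp
    simp only [Finset.mem_sigma, Finset.mem_filter, Finset.mem_univ, true_and] at hp ⊢
    rw [← Finset.insert_erase hp.1, ← hp.2]
    ext x
    simp only [Finset.mem_image, Finset.mem_univ, true_and, Finset.mem_insert,
      Equiv.funSplitAt_symm_apply, Subtype.exists]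
    constructor
    · rintro ⟨i, rfl⟩
      by_cases hi : i = r
      · simp [hi]
      · exact Or.inr ⟨i, hi, by simp [hi]⟩
    · rintro (rfl | ⟨i, hi, rfl⟩)
      · exact ⟨r, by simp⟩
      · exact ⟨i, by simp [hi]⟩
  · intro f _
    exact (Equiv.funSplitAt r κ).symm_apply_apply f
  · rintro ⟨j, g⟩ _
    have h := (Equiv.funSplitAt r κ).apply_symm_apply (j, g)
    simp only [Prod.ext_iff] at h
    exact Sigma.ext h.1 (heq_of_eq h.2)
  · intro f _
    exact Fintype.prod_eq_mul_prod_subtype_ne (fun i => M i (f i)) r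

end Matrix

theorem stmt6 (k : Type*) [Field k] (d : ℕ)
    (hchar : ringChar k = 0 ∨ d < ringChar k)
    (M : Matrix (Fin d) (Fin (2 * d - 1)) k)
    (hM : ∀ c : Fin d → Fin (2 * d - 1), StrictMono c →
      Matrix.permanent (Matrix.of fun i j => M i (c j)) = 0)
    (r : Fin d) :
    (∃ j, M r j = 0) ∨
      ∀ c : {i : Fin d // i ≠ r} → Fin (2 * d - 1), Function.Injective c →
        Matrix.permanent (Matrix.of fun (i j : {i : Fin d // i ≠ r}) => M i.val (c j)) = 0 := by
  refine or_iff_not_imp_left.2 fun hr c hc => ?_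
  push Not at hr
  have hd : 0 < d := r.pos
  let N := M.submatrix ((↑) : {i // i ≠ r} → Fin d) id
  have hcard : (Finset.univ.image c).card = d - 1 := by
    rw [Finset.card_image_of_injective _ hc]
    simp
  have hK (i : ℕ) (hi : i ≤ d - 1) : ((i + 1 : ℕ) : k) ≠ 0 := by
    rw [Ne, ringChar.spec]
    rcases hchar with h | h
    · simp [h]
    · exact Nat.not_dvd_of_pos_of_lt i.succ_pos (by omega)
  have hQ (T : Finset (Fin (2 * d - 1))) (hT : T.card = d - 1 + 1) :
      ∑ j ∈ T, N.permanentOn (T.erase j) / ∏ l ∈ T.erase j, M r l = 0 := by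
    have hTd : T.card = d := by omega
    have hzero : M.permanentOn T = 0 := by
      have := M.permanentOn_image (T.orderEmbOfFin hTd).injective
      rwa [hM _ (T.orderEmbOfFin hTd).strictMono, Finset.image_orderEmbOfFin_univ] at this
    rw [M.permanentOn_eq_sum_erase r (by simpa using hTd)] at hzero
    rw [← zero_div (∏ l ∈ T, M r l), ← hzero, Finset.sum_div]
    refine Finset.sum_congr rfl fun j hj => ?_
    rw [← Finset.mul_prod_erase T _ hj, mul_div_mul_left _ _ (hr j)]
  have hzero := eq_zero_of_sum_erase_eq_zero (by simp; omega) hK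
    (fun S => N.permanentOn S / ∏ l ∈ S, M r l) hQ hcard
  rw [div_eq_zero_iff, or_iff_left (Finset.prod_ne_zero_iff.2 fun j _ => hr j),
    N.permanentOn_image hc] at hzero
  exact hzero
end

section
/- Let k be a field with char k ≠ 2 and char k ≠ 3, and let I_3(3,5) be the ideal of 3×3 subpermanents of the generic 3×5 matrix M = (x_{i,j}) in k[x_{i,j} : 1 ≤ i ≤ 3, 1 ≤ j ≤ 5]. Then every minimal prime ideal 𝔭 over I_3(3,5) either contains an entire column {x_{1,j}, x_{2,j}, x_{3,j}} of M for some j ∈ {1, …, 5}, or there are two rows r ≠ r' of M such that 𝔭 contains all 2×2 permanents x_{r,j} x_{r',j'} + x_{r,j'} x_{r',j} (1 ≤ j < j' ≤ 5) of those two rows. -/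
open MvPolynomial

/-- The polarized monomial `xyz`: the permanent of the columns `i`, `j`, `k` of the matrix with rows
`x`, `y`, `z`. -/
def columnPermanent {K ι : Type*} [CommRing K] (x y z : ι → K) (i j k : ι) : K :=
  x i * (y j * z k + y k * z j) + x j * (y i * z k + y k * z i) + x k * (y i * z j + y j * z i)

/-- All `2 × 2` permanents of the matrix with rows `a`, `b` vanish. -/
def PairwisePermanentZero {K ι : Type*} [CommRing K] (a b : ι → K) : Prop :=
  ∀ i j, i ≠ j → a i * b j + a j * b i = 0

/-- Some two of the rows `x`, `y`, `z` have vanishing `2 × 2` permanents. -/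
def HasDegenerateRows {K ι : Type*} [CommRing K] (x y z : ι → K) : Prop :=
  PairwisePermanentZero x y ∨ PairwisePermanentZero x z ∨ PairwisePermanentZero y z

theorem permanent_fin_three {R : Type*} [CommRing R] (A : Matrix (Fin 3) (Fin 3) R) :
    A.permanent = A 0 0 * A 1 1 * A 2 2 + A 0 0 * A 2 1 * A 1 2 + A 1 0 * A 0 1 * A 2 2
      + A 1 0 * A 2 1 * A 0 2 + A 2 0 * A 0 1 * A 1 2 + A 2 0 * A 1 1 * A 0 2 := by
  have huniv : (Finset.univ : Finset (Equiv.Perm (Fin 3))) =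
      {1, Equiv.swap 1 2, Equiv.swap 0 1, Equiv.swap 0 1 * Equiv.swap 1 2,
        Equiv.swap 0 2 * Equiv.swap 1 2, Equiv.swap 0 2} := by decide
  rw [Matrix.permanent, huniv]
  iterate 5 rw [Finset.sum_insert (by decide)]
  rw [Finset.sum_singleton]
  simp only [Fin.prod_univ_three, Equiv.Perm.mul_apply, Equiv.Perm.one_apply, Equiv.swap_apply_def,
    Fin.reduceEq, if_true, if_false]
  ring

section

variable {K ι : Type*}

theorem PairwisePermanentZero.symm [CommRing K] {a b : ι → K} (h : PairwisePermanentZero a b) :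
    PairwisePermanentZero b a := fun i j hij => by linear_combination h i j hij

theorem PairwisePermanentZero.of_left_eq_zero [CommRing K] {a : ι → K} (b : ι → K)
    (h : ∀ i, a i = 0) : PairwisePermanentZero a b := fun i j _ => by simp [h]

theorem HasDegenerateRows.swap [CommRing K] {x y z : ι → K} (h : HasDegenerateRows x y z) :
    HasDegenerateRows y x z := by
  rcases h with h | h | h
  · exact Or.inl h.symm
  · exact Or.inr (Or.inr h)
  · exact Or.inr (Or.inl h)

theorem HasDegenerateRows.rotate [CommRing K] {x y z : ι → K} (h : HasDegenerateRows x y z) :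
    HasDegenerateRows z x y := by
  rcases h with h | h | h
  · exact Or.inr (Or.inr h)
  · exact Or.inl h.symm
  · exact Or.inr (Or.inl h.symm)

theorem columnPermanent_swap [CommRing K] (x y z : ι → K) (i j k : ι) :
    columnPermanent y x z i j k = columnPermanent x y z i j k := by
  unfold columnPermanent; ring

theorem columnPermanent_rotate [CommRing K] (x y z : ι → K) (i j k : ι) :
    columnPermanent z x y i j k = columnPermanent x y z i j k := by
  unfold columnPermanent; ring

/-- If two vectors of `K³` are not proportional, every vector coplanar with them is a linear
combination of them. -/
theorem exists_combination_of_det_eq_zero [Field K] (x y z : ι → K) {i j a : ι}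
    (hij : ¬(y i * z j - y j * z i = 0 ∧ x i * z j - x j * z i = 0 ∧ x i * y j - x j * y i = 0))
    (hdet : x a * (y i * z j - y j * z i) - y a * (x i * z j - x j * z i)
      + z a * (x i * y j - x j * y i) = 0) :
    ∃ α β : K, x a = α * x i + β * x j ∧ y a = α * y i + β * y j ∧ z a = α * z i + β * z j := by
  by_cases h1 : y i * z j - y j * z i = 0
  · by_cases h2 : x i * z j - x j * z i = 0
    · have h3 : x i * y j - x j * y i ≠ 0 := fun h3 => hij ⟨h1, h2, h3⟩
      refine ⟨(x a * y j - x j * y a) / (x i * y j - x j * y i),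
        (x i * y a - x a * y i) / (x i * y j - x j * y i), ?_, ?_, ?_⟩
      all_goals
        rw [div_mul_eq_mul_div, div_mul_eq_mul_div, ← add_div, eq_div_iff h3]
      · ring
      · ring
      · linear_combination hdet
    · refine ⟨(x a * z j - x j * z a) / (x i * z j - x j * z i),
        (x i * z a - x a * z i) / (x i * z j - x j * z i), ?_, ?_, ?_⟩
      all_goals
        rw [div_mul_eq_mul_div, div_mul_eq_mul_div, ← add_div, eq_div_iff h2]
      · ring
      · linear_combination -hdet
      · ring
  · refine ⟨(y a * z j - y j * z a) / (y i * z j - y j * z i),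
      (y i * z a - y a * z i) / (y i * z j - y j * z i), ?_, ?_, ?_⟩
    all_goals
      rw [div_mul_eq_mul_div, div_mul_eq_mul_div, ← add_div, eq_div_iff h1]
    · linear_combination hdet
    · ring
    · ring

/-- If a column is supported on a coordinate axis, the other two rows are degenerate. -/
theorem pairwisePermanentZero_of_column_on_axis [Field K] {x y z : ι → K} {i : ι}
    (H : ∀ a b c, a ≠ b → a ≠ c → b ≠ c → columnPermanent x y z a b c = 0)
    (hxi : x i ≠ 0) (hyi : y i = 0) (hzi : z i = 0) :
    PairwisePermanentZero y z := by
  intro a b hab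
  by_cases hai : a = i
  · simp [hai, hyi, hzi]
  by_cases hbi : b = i
  · simp [hbi, hyi, hzi]
  have h := H i a b (Ne.symm hai) (Ne.symm hbi) hab
  simp only [columnPermanent, hyi, hzi] at h
  have h' : x i * (y a * z b + y b * z a) = 0 := by linear_combination h
  exact (mul_eq_zero.mp h').resolve_left hxi

theorem hasDegenerateRows_of_columns_in_plane [Field K] (h2 : (2 : K) ≠ 0) {x y z : Fin 5 → K}
    {i j : Fin 5} (hij : i ≠ j)
    (H : ∀ a b c, a ≠ b → a ≠ c → b ≠ c → columnPermanent x y z a b c = 0)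
    (hne : ∀ a, ¬(x a = 0 ∧ y a = 0 ∧ z a = 0)) (hzi : z i = 0) (hzj : z j = 0)
    (hxy : x i * y j + x j * y i = 0) : HasDegenerateRows x y z := by
  by_cases hxi : x i = 0
  · have hyi : y i ≠ 0 := fun h => hne i ⟨hxi, h, hzi⟩
    exact Or.inr (Or.inl (pairwisePermanentZero_of_column_on_axis
      (fun a b c hab hac hbc => (columnPermanent_swap x y z a b c).trans (H a b c hab hac hbc))
      hyi hxi hzi))
  by_cases hyj : y j = 0
  · have hxj : x j ≠ 0 := fun h => hne j ⟨h, hyj, hzj⟩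
    have hyi : y i = 0 := by simpa [hyj, hxj] using hxy
    exact Or.inr (Or.inr (pairwisePermanentZero_of_column_on_axis H hxi hyi hzi))
  have hdet : 2 * (x i * y j) ≠ 0 := mul_ne_zero h2 (mul_ne_zero hxi hyj)
  have key : ∀ a b, a ≠ i → a ≠ j → b ≠ i → b ≠ j → a ≠ b →
      y a * z b + y b * z a = 0 ∧ x a * z b + x b * z a = 0 := by
    intro a b hai haj hbi hbj hab
    have e1 := H i a b hai.symm hbi.symm hab
    have e2 := H j a b haj.symm hbj.symm hab
    simp only [columnPermanent, hzi, hzj] at e1 e2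
    constructor
    · refine (mul_eq_zero.mp ?_).resolve_left hdet
      linear_combination y j * e1 - y i * e2 + (y a * z b + y b * z a) * hxy
    · refine (mul_eq_zero.mp ?_).resolve_left hdet
      linear_combination x i * e2 - x j * e1 + (x a * z b + x b * z a) * hxy
  by_cases hz : ∀ a, z a = 0
  · exact Or.inr (Or.inl (PairwisePermanentZero.of_left_eq_zero x hz).symm)
  push Not at hz
  obtain ⟨a, ha⟩ := hz
  have hai : a ≠ i := by rintro rfl; exact ha hzi
  have haj : a ≠ j := by rintro rfl; exact ha hzj
  have hz' : ∀ b, b ≠ i → b ≠ j → z b ≠ 0 := by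
    intro b hbi hbj hb
    have hba : a ≠ b := by rintro rfl; exact ha hb
    obtain ⟨e1, e2⟩ := key a b hai haj hbi hbj hba
    exact hne b ⟨by simpa [hb, ha] using e2, by simpa [hb, ha] using e1, hb⟩
  have hxy0 : ∀ b, b ≠ i → b ≠ j → x b = 0 ∧ y b = 0 := by
    intro b hbi hbj
    obtain ⟨c, d, hci, hcj, hcb, hdi, hdj, hdb, hcd⟩ : ∃ c d : Fin 5,
        c ≠ i ∧ c ≠ j ∧ c ≠ b ∧ d ≠ i ∧ d ≠ j ∧ d ≠ b ∧ c ≠ d := by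
      clear * -
      decide +revert
    obtain ⟨e1, e2⟩ := key b c hbi hbj hci hcj hcb.symm
    obtain ⟨e3, e4⟩ := key b d hbi hbj hdi hdj hdb.symm
    obtain ⟨e5, e6⟩ := key c d hci hcj hdi hdj hcd
    have hnz : 2 * (z c * z d) ≠ 0 := mul_ne_zero h2 (mul_ne_zero (hz' c hci hcj) (hz' d hdi hdj))
    constructor
    · refine (mul_eq_zero.mp ?_).resolve_left hnz
      linear_combination z d * e2 + z c * e4 - z b * e6
    · refine (mul_eq_zero.mp ?_).resolve_left hnz
      linear_combination z d * e1 + z c * e3 - z b * e5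
  refine Or.inl fun a b hab => ?_
  by_cases hai' : a = i
  · by_cases hbj' : b = j
    · rw [hai', hbj']; exact hxy
    · have := hxy0 b (fun h => hab (hai'.trans h.symm)) hbj'
      simp [this.1, this.2]
  by_cases haj' : a = j
  · by_cases hbi' : b = i
    · rw [haj', hbi']; linear_combination hxy
    · have := hxy0 b hbi' (fun h => hab (haj'.trans h.symm))
      simp [this.1, this.2]
  have := hxy0 a hai' haj'
  simp [this.1, this.2]

/-- If the three `2 × 2` permanents of two columns vanish, two of the rows are degenerate. -/
theorem hasDegenerateRows_of_column_pair [Field K] (h2 : (2 : K) ≠ 0) {x y z : Fin 5 → K}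
    {i j : Fin 5} (hij : i ≠ j)
    (H : ∀ a b c, a ≠ b → a ≠ c → b ≠ c → columnPermanent x y z a b c = 0)
    (hne : ∀ a, ¬(x a = 0 ∧ y a = 0 ∧ z a = 0))
    (hxy : x i * y j + x j * y i = 0) (hxz : x i * z j + x j * z i = 0)
    (hyz : y i * z j + y j * z i = 0) : HasDegenerateRows x y z := by
  by_cases hz : z i = 0 ∧ z j = 0
  · exact hasDegenerateRows_of_columns_in_plane h2 hij H hne hz.1 hz.2 hxy
  by_cases hy : y i = 0 ∧ y j = 0
  · refine (hasDegenerateRows_of_columns_in_plane (x := z) (y := x) (z := y) h2 hij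
      (fun a b c hab hac hbc => (columnPermanent_rotate x y z a b c).trans (H a b c hab hac hbc))
      (fun a h => hne a ⟨h.2.1, h.2.2, h.1⟩) hy.1 hy.2
      (by linear_combination hxz)).rotate.rotate
  by_cases hx : x i = 0 ∧ x j = 0
  · refine (hasDegenerateRows_of_columns_in_plane (x := y) (y := z) (z := x) h2 hij
      (fun a b c hab hac hbc => ((columnPermanent_rotate z x y a b c).trans
        (columnPermanent_rotate x y z a b c)).trans (H a b c hab hac hbc))
      (fun a h => hne a ⟨h.2.2, h.1, h.2.1⟩) hx.1 hx.2 hyz).rotate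
  exfalso
  have p1 : x i * y j * z j = 0 := (mul_eq_zero.mp (show 2 * (x i * y j * z j) = 0 by
    linear_combination z j * hxy + y j * hxz - x j * hyz)).resolve_left h2
  have p2 : x j * y i * z j = 0 := (mul_eq_zero.mp (show 2 * (x j * y i * z j) = 0 by
    linear_combination z j * hxy + x j * hyz - y j * hxz)).resolve_left h2
  have p3 : x j * y j * z i = 0 := (mul_eq_zero.mp (show 2 * (x j * y j * z i) = 0 by
    linear_combination y j * hxz + x j * hyz - z j * hxy)).resolve_left h2
  have p4 : x j * y i * z i = 0 := (mul_eq_zero.mp (show 2 * (x j * y i * z i) = 0 by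
    linear_combination z i * hxy + y i * hxz - x i * hyz)).resolve_left h2
  have p5 : x i * y j * z i = 0 := (mul_eq_zero.mp (show 2 * (x i * y j * z i) = 0 by
    linear_combination z i * hxy + x i * hyz - y i * hxz)).resolve_left h2
  grind

/-- A column `k` whose polar conic is singular along all columns forces degenerate rows, unless it
lies on a coordinate axis. -/
theorem hasDegenerateRows_of_polar_eq_zero [Field K] (h2 : (2 : K) ≠ 0) (h3 : (3 : K) ≠ 0)
    {x y z : ι → K} {k : ι} (hk : ∀ a, columnPermanent x y z k k a = 0) :
    HasDegenerateRows x y z ∨ (x k = 0 ∧ y k = 0) ∨ (x k = 0 ∧ z k = 0) ∨ (y k = 0 ∧ z k = 0) := by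
  have e : ∀ a, y k * z k * x a + x k * z k * y a + x k * y k * z a = 0 := fun a =>
    (mul_eq_zero.mp (show 2 * (y k * z k * x a + x k * z k * y a + x k * y k * z a) = 0 by
      have := hk a
      unfold columnPermanent at this
      linear_combination this)).resolve_left h2
  have h : x k * (y k * z k) = 0 := (mul_eq_zero.mp (show 3 * (x k * (y k * z k)) = 0 by
    linear_combination e k)).resolve_left h3
  by_cases hx : x k = 0
  · by_cases hy : y k = 0
    · exact Or.inr (Or.inl ⟨hx, hy⟩)
    by_cases hz : z k = 0
    · exact Or.inr (Or.inr (Or.inl ⟨hx, hz⟩))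
    refine Or.inl (Or.inl (PairwisePermanentZero.of_left_eq_zero y fun a => ?_))
    simpa [hx, hy, hz] using e a
  by_cases hy : y k = 0
  · by_cases hz : z k = 0
    · exact Or.inr (Or.inr (Or.inr ⟨hy, hz⟩))
    refine Or.inl (Or.inl (PairwisePermanentZero.of_left_eq_zero x fun a => ?_).symm)
    simpa [hx, hy, hz] using e a
  have hz : z k = 0 := by simpa [hx, hy] using h
  refine Or.inl (Or.inr (Or.inl (PairwisePermanentZero.of_left_eq_zero x fun a => ?_).symm))
  simpa [hx, hy, hz] using e a

theorem hasDegenerateRows_of_polar_form_eq_zero [Field K] (h2 : (2 : K) ≠ 0) (h3 : (3 : K) ≠ 0)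
    {x y z : ι → K} {k : ι} (hk0 : ¬(x k = 0 ∧ y k = 0 ∧ z k = 0))
    (hk : ∀ a b, columnPermanent x y z k a b = 0) : HasDegenerateRows x y z := by
  rcases hasDegenerateRows_of_polar_eq_zero h2 h3 (hk k) with h | ⟨h, h'⟩ | ⟨h, h'⟩ | ⟨h, h'⟩
  · exact h
  · have hz : z k ≠ 0 := fun hz => hk0 ⟨h, h', hz⟩
    refine Or.inl fun a b _ => (mul_eq_zero.mp ?_).resolve_left hz
    have := hk a b
    simp only [columnPermanent, h, h'] at this
    linear_combination this
  · have hy : y k ≠ 0 := fun hy => hk0 ⟨h, hy, h'⟩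
    refine Or.inr (Or.inl fun a b _ => (mul_eq_zero.mp ?_).resolve_left hy)
    have := hk a b
    simp only [columnPermanent, h, h'] at this
    linear_combination this
  · have hx : x k ≠ 0 := fun hx => hk0 ⟨hx, h, h'⟩
    refine Or.inr (Or.inr fun a b _ => (mul_eq_zero.mp ?_).resolve_left hx)
    have := hk a b
    simp only [columnPermanent, h, h'] at this
    linear_combination this

/-- A vector proportional to a nonzero vector is a multiple of it. -/
theorem exists_multiple_of_cross_eq_zero [Field K] {x y z : ι → K} {i j : ι}
    (hi : ¬(x i = 0 ∧ y i = 0 ∧ z i = 0))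
    (hij : y i * z j - y j * z i = 0 ∧ x i * z j - x j * z i = 0 ∧ x i * y j - x j * y i = 0) :
    ∃ α : K, x j = α * x i ∧ y j = α * y i ∧ z j = α * z i := by
  obtain ⟨e1, e2, e3⟩ := hij
  by_cases hx : x i = 0
  · by_cases hy : y i = 0
    · have hz : z i ≠ 0 := fun hz => hi ⟨hx, hy, hz⟩
      refine ⟨z j / z i, ?_, ?_, ?_⟩ <;> field_simp
      · linear_combination -e2
      · linear_combination -e1
    · refine ⟨y j / y i, ?_, ?_, ?_⟩ <;> field_simp
      · linear_combination -e3
      · linear_combination e1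
  · refine ⟨x j / x i, ?_, ?_, ?_⟩ <;> field_simp
    · linear_combination e3
    · linear_combination e2

/-- A `3 × 5` matrix without zero columns, all of whose `3 × 3` permanents vanish, has two rows all
of whose `2 × 2` permanents vanish. -/
theorem hasDegenerateRows_of_columnPermanent_eq_zero [Field K] (h2 : (2 : K) ≠ 0)
    (h3 : (3 : K) ≠ 0) {x y z : Fin 5 → K}
    (H : ∀ a b c, a ≠ b → a ≠ c → b ≠ c → columnPermanent x y z a b c = 0)
    (hne : ∀ a, ¬(x a = 0 ∧ y a = 0 ∧ z a = 0)) : HasDegenerateRows x y z := by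
  by_contra hcon
  have hL : ∀ i j, i ≠ j → ¬(x i * y j + x j * y i = 0 ∧ x i * z j + x j * z i = 0 ∧
      y i * z j + y j * z i = 0) := fun i j hij h =>
    hcon (hasDegenerateRows_of_column_pair h2 hij H hne h.1 h.2.1 h.2.2)
  have hdet : ∀ i j a, i ≠ j → i ≠ a → j ≠ a →
      x a * (y i * z j - y j * z i) - y a * (x i * z j - x j * z i)
        + z a * (x i * y j - x j * y i) = 0 := by
    intro i j a hij hia hja
    obtain ⟨l, m, hli, hlj, hla, hmi, hmj, hma, hlm⟩ : ∃ l m : Fin 5,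
        l ≠ i ∧ l ≠ j ∧ l ≠ a ∧ m ≠ i ∧ m ≠ j ∧ m ≠ a ∧ l ≠ m := by
      clear * -
      decide +revert
    have e1 := H l m i hlm hli hmi
    have e2 := H l m j hlm hlj hmj
    have e3 := H l m a hlm hla hma
    unfold columnPermanent at e1 e2 e3
    by_contra hD
    refine hL l m hlm ⟨?_, ?_, ?_⟩ <;> refine (mul_eq_zero.mp ?_).resolve_left hD
    · linear_combination (x i * y j - x j * y i) * e3 + (x j * y a - x a * y j) * e1
        + (x a * y i - x i * y a) * e2
    · linear_combination -(x i * z j - x j * z i) * e3 - (x j * z a - x a * z j) * e1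
        - (x a * z i - x i * z a) * e2
    · linear_combination (y i * z j - y j * z i) * e3 + (y j * z a - y a * z j) * e1
        + (y a * z i - y i * z a) * e2
  have hspan : ∀ i j, i ≠ j →
      ¬(y i * z j - y j * z i = 0 ∧ x i * z j - x j * z i = 0 ∧ x i * y j - x j * y i = 0) →
      ∀ a, ∃ α β : K,
        x a = α * x i + β * x j ∧ y a = α * y i + β * y j ∧ z a = α * z i + β * z j := by
    intro i j hij hnp a
    refine exists_combination_of_det_eq_zero x y z hnp ?_
    by_cases hia : i = a
    · subst hia; ring
    by_cases hja : j = a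
    · subst hja; ring
    exact hdet i j a hij hia hja
  have extend : ∀ i j, i ≠ j →
      ¬(y i * z j - y j * z i = 0 ∧ x i * z j - x j * z i = 0 ∧ x i * y j - x j * y i = 0) →
      ∀ p q, columnPermanent x y z p q i = 0 → columnPermanent x y z p q j = 0 →
        ∀ a, columnPermanent x y z p q a = 0 := by
    intro i j hij hnp p q hi hj a
    obtain ⟨α, β, hx, hy, hz⟩ := hspan i j hij hnp a
    unfold columnPermanent at hi hj ⊢
    rw [hx, hy, hz]
    linear_combination α * hi + β * hj
  have comm : ∀ p q a, columnPermanent x y z p q a = columnPermanent x y z p a q := by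
    intro p q a; unfold columnPermanent; ring
  have comm' : ∀ p q a, columnPermanent x y z p q a = columnPermanent x y z q p a := by
    intro p q a; unfold columnPermanent; ring
  by_cases hprop : ∀ i j, i ≠ j →
      (y i * z j - y j * z i = 0 ∧ x i * z j - x j * z i = 0 ∧ x i * y j - x j * y i = 0)
  · have hmul : ∀ a, ∃ α : K, α ≠ 0 ∧ x a = α * x 0 ∧ y a = α * y 0 ∧ z a = α * z 0 := by
      intro a
      by_cases ha : (0 : Fin 5) = a
      · subst ha; exact ⟨1, one_ne_zero, by simp⟩
      obtain ⟨α, hx, hy, hz⟩ := exists_multiple_of_cross_eq_zero (hne 0) (hprop 0 a ha)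
      refine ⟨α, ?_, hx, hy, hz⟩
      rintro rfl
      exact hne a ⟨by simpa using hx, by simpa using hy, by simpa using hz⟩
    have h0 : x 0 * (y 0 * z 0) = 0 := by
      obtain ⟨α, hα, hx, hy, hz⟩ := hmul 1
      obtain ⟨β, hβ, hx', hy', hz'⟩ := hmul 2
      have h := H 0 1 2 (by decide) (by decide) (by decide)
      unfold columnPermanent at h
      rw [hx, hy, hz, hx', hy', hz'] at h
      have h' : 2 * 3 * (α * β) * (x 0 * (y 0 * z 0)) = 0 := by linear_combination h
      exact (mul_eq_zero.mp h').resolve_left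
        (mul_ne_zero (mul_ne_zero h2 h3) (mul_ne_zero hα hβ))
    rcases mul_eq_zero.mp h0 with h0 | h0
    · refine hcon (Or.inl (PairwisePermanentZero.of_left_eq_zero y fun a => ?_))
      obtain ⟨α, -, hx, -, -⟩ := hmul a
      rw [hx, h0, mul_zero]
    rcases mul_eq_zero.mp h0 with h0 | h0
    · refine hcon (Or.inl (PairwisePermanentZero.of_left_eq_zero x fun a => ?_).symm)
      obtain ⟨α, -, -, hy, -⟩ := hmul a
      rw [hy, h0, mul_zero]
    · refine hcon (Or.inr (Or.inl (PairwisePermanentZero.of_left_eq_zero x fun a => ?_).symm))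
      obtain ⟨α, -, -, -, hz⟩ := hmul a
      rw [hz, h0, mul_zero]
  push Not at hprop
  obtain ⟨i, j, hij, hnp⟩ := hprop
  have hnp' : ¬(y i * z j - y j * z i = 0 ∧ x i * z j - x j * z i = 0 ∧
      x i * y j - x j * y i = 0) := fun h => hnp h.1 h.2.1 h.2.2
  have polar : ∀ p q, p ≠ q → p ≠ i → p ≠ j → q ≠ i → q ≠ j →
      ∀ a, columnPermanent x y z p q a = 0 := fun p q hpq hpi hpj hqi hqj =>
    extend i j hij hnp' p q (H p q i hpq hpi hqi) (H p q j hpq hpj hqj)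
  obtain ⟨k, l, m, hki, hkj, hli, hlj, hmi, hmj, hkl, hkm, hlm⟩ : ∃ k l m : Fin 5,
      k ≠ i ∧ k ≠ j ∧ l ≠ i ∧ l ≠ j ∧ m ≠ i ∧ m ≠ j ∧ k ≠ l ∧ k ≠ m ∧ l ≠ m := by
    clear * -
    decide +revert
  have indep : ∀ k l m, k ≠ i → k ≠ j → l ≠ i → l ≠ j → m ≠ i → m ≠ j → k ≠ l → k ≠ m → l ≠ m →
      y l * z m - y m * z l = 0 ∧ x l * z m - x m * z l = 0 ∧ x l * y m - x m * y l = 0 := by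
    intro k l m hki hkj hli hlj hmi hmj hkl hkm hlm
    by_contra h
    refine hcon (hasDegenerateRows_of_polar_form_eq_zero h2 h3 (hne k) fun a b => ?_)
    refine extend l m hlm h k a ?_ ?_ b
    · rw [comm]; exact polar k l hkl hki hkj hli hlj a
    · rw [comm]; exact polar k m hkm hki hkj hmi hmj a
  obtain ⟨α, hx, hy, hz⟩ := exists_multiple_of_cross_eq_zero (hne k)
    (indep m k l hmi hmj hki hkj hli hlj hkm.symm hlm.symm hkl)
  have hα : α ≠ 0 := by
    rintro rfl
    exact hne l ⟨by simpa using hx, by simpa using hy, by simpa using hz⟩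
  have hkk : ∀ a, columnPermanent x y z k k a = 0 := by
    intro a
    refine (mul_eq_zero.mp ?_).resolve_left hα
    have h := polar k l hkl hki hkj hli hlj a
    unfold columnPermanent at h ⊢
    rw [hx, hy, hz] at h
    linear_combination h
  rcases hasDegenerateRows_of_polar_eq_zero h2 h3 hkk with h | ⟨h, h'⟩ | ⟨h, h'⟩ | ⟨h, h'⟩
  · exact hcon h
  all_goals
    refine hL k l hkl ⟨?_, ?_, ?_⟩ <;> simp [hx, hy, hz, h, h']

end

theorem stmt7 (k : Type*) [Field k] (h2 : ringChar k ≠ 2) (h3 : ringChar k ≠ 3)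
    (𝔭 : Ideal (MvPolynomial (Fin 3 × Fin 5) k))
    (h𝔭 : 𝔭 ∈ (permIdeal k 3 3 5).minimalPrimes) :
    (∃ j : Fin 5, ∀ i : Fin 3, X (i, j) ∈ 𝔭) ∨
      (∃ r r' : Fin 3, r ≠ r' ∧ ∀ j j' : Fin 5, j < j' →
        X (r, j) * X (r', j') + X (r, j') * X (r', j) ∈ 𝔭) := by
  have := h𝔭.1.1
  set R := MvPolynomial (Fin 3 × Fin 5) k
  let K := FractionRing (R ⧸ 𝔭)
  let φ : R →+* K := (algebraMap (R ⧸ 𝔭) K).comp (Ideal.Quotient.mk 𝔭)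
  have hφ : ∀ f, φ f = 0 ↔ f ∈ 𝔭 := fun f => by
    rw [← Ideal.Quotient.eq_zero_iff_mem]
    exact FaithfulSMul.algebraMap_eq_zero_iff (R ⧸ 𝔭) K
  have h2' : (2 : K) ≠ 0 := by
    have h := (map_ne_zero (φ.comp (C : k →+* R))).mpr (Ring.two_ne_zero h2)
    rwa [map_ofNat] at h
  have h3' : (3 : K) ≠ 0 := by
    have h3k : (3 : k) ≠ 0 := fun h => by
      have hd := (ringChar.spec k 3).mp (by exact_mod_cast h)
      rcases (Nat.dvd_prime Nat.prime_three).mp hd with h1 | h1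
      · exact CharP.ringChar_ne_one h1
      · exact h3 h1
    have h := (map_ne_zero (φ.comp (C : k →+* R))).mpr h3k
    rwa [map_ofNat] at h
  by_cases hcol : ∃ j : Fin 5, ∀ i : Fin 3, X (i, j) ∈ 𝔭
  · exact Or.inl hcol
  refine Or.inr ?_
  let v : Fin 3 → Fin 5 → K := fun i j => φ (X (i, j))
  have hmono : ∀ a b c : Fin 5, a < b → b < c → columnPermanent (v 0) (v 1) (v 2) a b c = 0 := by
    intro a b c hab hbc
    have hmem : Matrix.permanent (Matrix.of fun i j : Fin 3 =>
        (X (i, ![a, b, c] j) : R)) ∈ 𝔭 := by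
      refine h𝔭.1.2 (Ideal.subset_span ⟨id, ![a, b, c], strictMono_id, ?_, rfl⟩)
      rw [Fin.strictMono_iff_lt_succ]
      intro i
      fin_cases i
      · exact hab
      · exact hbc
    have h := (hφ _).mpr hmem
    rw [permanent_fin_three] at h
    simp only [map_add, map_mul, Matrix.of_apply, Matrix.cons_val] at h
    simp only [columnPermanent, v]
    linear_combination h
  have H : ∀ a b c : Fin 5, a ≠ b → a ≠ c → b ≠ c →
      columnPermanent (v 0) (v 1) (v 2) a b c = 0 := by
    intro a b c hab hac hbc
    rcases lt_or_gt_of_ne hab with h | h <;> rcases lt_or_gt_of_ne hac with h' | h' <;>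
      rcases lt_or_gt_of_ne hbc with h'' | h''
    · exact hmono a b c h h''
    · rw [← hmono a c b h' h'']; unfold columnPermanent; ring
    · exact absurd (h.trans h'') h'.asymm
    · rw [← hmono c a b h' h]; unfold columnPermanent; ring
    · rw [← hmono b a c h h']; unfold columnPermanent; ring
    · exact absurd (h''.trans h) h'.asymm
    · rw [← hmono b c a h'' h']; unfold columnPermanent; ring
    · rw [← hmono c b a h'' h]; unfold columnPermanent; ring
  have hne : ∀ a, ¬(v 0 a = 0 ∧ v 1 a = 0 ∧ v 2 a = 0) := by
    rintro a ⟨e0, e1, e2⟩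
    refine hcol ⟨a, fun i => (hφ _).mp ?_⟩
    fin_cases i
    exacts [e0, e1, e2]
  have hmem : ∀ r r' : Fin 3, PairwisePermanentZero (v r) (v r') → ∀ j j' : Fin 5, j < j' →
      X (r, j) * X (r', j') + X (r, j') * X (r', j) ∈ 𝔭 := by
    intro r r' h j j' hjj
    rw [← hφ]
    simpa [v] using h j j' hjj.ne
  rcases hasDegenerateRows_of_columnPermanent_eq_zero h2' h3' H hne with h | h | h
  · exact ⟨0, 1, by decide, hmem 0 1 h⟩
  · exact ⟨0, 2, by decide, hmem 0 2 h⟩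
  · exact ⟨1, 2, by decide, hmem 1 2 h⟩
end

section
/- Let k be a field and let M = (x_{i,j}) be the generic d×(d+1) matrix over k. For 1 ≤ q ≤ d+1, let P_q be the permanent of the d×d matrix obtained from M by deleting column q, and for 1 ≤ r ≤ d and 1 ≤ p, q ≤ d+1 let B_{r,p,q} = ∂P_q/∂x_{r,p} (so B_{r,p,p} = 0, and for p ≠ q, B_{r,p,q} is the (d-1)×(d-1) subpermanent of M omitting row r and columns p, q). For each p, let L_p be the d×d matrix with rows indexed by r ∈ {1,…,d} and columns indexed by s ∈ {1,…,d+1} \ {p}, with entry B_{r,s,p}, and set f_p = det L_p. For each r, let W_r be the (d+1)×(d+1) matrix with entries B_{r,p,q} for 1 ≤ p, q ≤ d+1, and set g_r = det W_r. Then for all i ∈ {1,…,d} and j ∈ {1,…,d+1}, both x_{i,j} · f_j and x_{i,j} · g_i lie in I_d(d,d+1). -/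
open MvPolynomial

/-- `P_q`: the permanent of the `d × d` matrix obtained from the generic `d × (d+1)`
matrix by deleting column `q`. -/
noncomputable def Pq (k : Type*) [Field k] (d : ℕ) (q : Fin (d + 1)) :
    MvPolynomial (Fin d × Fin (d + 1)) k :=
  Matrix.permanent (Matrix.of fun (i j : Fin d) => X (i, q.succAbove j))

/-- `B_{r,p,q} = ∂P_q/∂x_{r,p}`. -/
noncomputable def Bpd (k : Type*) [Field k] (d : ℕ) (r : Fin d) (p q : Fin (d + 1)) :
    MvPolynomial (Fin d × Fin (d + 1)) k :=
  MvPolynomial.pderiv (r, p) (Pq k d q)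

/-- `f_p`: the determinant of the `d × d` matrix `(B_{r,s,p})` with `s` ranging over
the columns different from `p`. -/
noncomputable def fp (k : Type*) [Field k] (d : ℕ) (p : Fin (d + 1)) :
    MvPolynomial (Fin d × Fin (d + 1)) k :=
  Matrix.det (Matrix.of fun (r s : Fin d) => Bpd k d r (p.succAbove s) p)

/-- `g_r`: the determinant of the `(d+1) × (d+1)` matrix `(B_{r,p,q})_{p,q}`. -/
noncomputable def gr (k : Type*) [Field k] (d : ℕ) (r : Fin d) :
    MvPolynomial (Fin d × Fin (d + 1)) k :=
  Matrix.det (Matrix.of fun (p q : Fin (d + 1)) => Bpd k d r p q)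

/-- If every entry of `v ᵥ* A` lies in `I`, then so does `v j * det A`. -/
theorem mul_det_mem_of_vecMul_mem {R n : Type*} [CommRing R] [Fintype n] [DecidableEq n]
    (I : Ideal R) (A : Matrix n n R) (v : n → R) (h : ∀ s, Matrix.vecMul v A s ∈ I) (j : n) :
    v j * A.det ∈ I := by
  have key : v j * A.det = ∑ s, Matrix.vecMul v A s * A.adjugate s j := by
    change _ = Matrix.vecMul (Matrix.vecMul v A) A.adjugate j
    rw [Matrix.vecMul_vecMul, Matrix.mul_adjugate, Matrix.vecMul_smul, Matrix.vecMul_one,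
      Pi.smul_apply, smul_eq_mul, mul_comm]
  rw [key]
  exact I.sum_mem fun s _ => I.mul_mem_right _ (h s)

/-- `P_q` as a sum over the injections of the rows into the columns that avoid `q`. -/
theorem Pq_eq_sum_injective (k : Type*) [Field k] (d : ℕ) (q : Fin (d + 1)) :
    Pq k d q = ∑ e : Fin d → Fin (d + 1) with Function.Injective e ∧ ∀ i, e i ≠ q,
      ∏ i, X (i, e i) := by
  rw [Pq, ← Matrix.permanent_transpose, Matrix.permanent]
  refine Finset.sum_bij (fun σ _ i => q.succAbove (σ i)) ?_ ?_ ?_ ?_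
  · intro σ _
    simp only [Finset.mem_filter, Finset.mem_univ, true_and]
    exact ⟨Fin.succAbove_right_injective.comp σ.injective, fun i => Fin.succAbove_ne q _⟩
  · intro σ _ τ _ h
    ext1 i
    exact Fin.succAbove_right_injective (congrFun h i)
  · intro e he
    obtain ⟨he, hq⟩ := (Finset.mem_filter.mp he).2
    choose f hf using fun i => Fin.exists_succAbove_eq (hq i)
    have hinj : Function.Injective f := fun a b hab => he (by rw [← hf a, ← hf b, hab])
    exact ⟨Equiv.ofBijective f (Finite.injective_iff_bijective.mp hinj), Finset.mem_univ _,
      funext hf⟩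
  · intro σ _
    rfl

theorem pderiv_prod_X (k : Type*) [Field k] (d : ℕ) (r : Fin d) (p : Fin (d + 1))
    (e : Fin d → Fin (d + 1)) :
    pderiv (r, p) (∏ i, X (i, e i) : MvPolynomial (Fin d × Fin (d + 1)) k) =
      if e r = p then ∏ i ∈ Finset.univ.erase r, X (i, e i) else 0 := by
  have hzero : pderiv (r, p)
      (∏ i ∈ Finset.univ.erase r, X (i, e i) : MvPolynomial (Fin d × Fin (d + 1)) k) = 0 := by
    refine Finset.prod_induction _ (fun f => pderiv (r, p) f = 0) ?_ ?_ ?_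
    · intro a b ha hb
      simp [ha, hb]
    · simp
    · intro i hi
      exact pderiv_X_of_ne fun h => Finset.ne_of_mem_erase hi (congrArg Prod.fst h)
  rw [← Finset.mul_prod_erase _ _ (Finset.mem_univ r), pderiv_mul, hzero, mul_zero, add_zero]
  split_ifs with h
  · rw [h, pderiv_X_self, one_mul]
  · rw [pderiv_X_of_ne fun h' => h (congrArg Prod.snd h'), zero_mul]

theorem Bpd_eq_sum (k : Type*) [Field k] (d : ℕ) (r : Fin d) (p q : Fin (d + 1)) :
    Bpd k d r p q = ∑ e : Fin d → Fin (d + 1) with Function.Injective e ∧ ∀ i, e i ≠ q,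
      if e r = p then ∏ i ∈ Finset.univ.erase r, X (i, e i) else 0 := by
  simp only [Bpd, Pq_eq_sum_injective, map_sum, pderiv_prod_X]

theorem X_mul_Bpd (k : Type*) [Field k] (d : ℕ) (r : Fin d) (p q : Fin (d + 1)) :
    X (r, p) * Bpd k d r p q =
      ∑ e : Fin d → Fin (d + 1) with Function.Injective e ∧ ∀ i, e i ≠ q,
        if e r = p then ∏ i, X (i, e i) else 0 := by
  rw [Bpd_eq_sum, Finset.mul_sum]
  refine Finset.sum_congr rfl fun e _ => ?_
  split_ifs with h
  · rw [← Finset.mul_prod_erase _ _ (Finset.mem_univ r), h]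
  · exact mul_zero _

theorem Bpd_symm (k : Type*) [Field k] (d : ℕ) (r : Fin d) (p q : Fin (d + 1)) :
    Bpd k d r p q = Bpd k d r q p := by
  simp only [Bpd_eq_sum, ← Finset.sum_filter, Finset.filter_filter]
  have hswap : ∀ p q : Fin (d + 1), ∀ e : Fin d → Fin (d + 1),
      ((Function.Injective e ∧ ∀ i, e i ≠ q) ∧ e r = p) →
      ((Function.Injective (Equiv.swap p q ∘ e) ∧ ∀ i, (Equiv.swap p q ∘ e) i ≠ p) ∧
        (Equiv.swap p q ∘ e) r = q) := by
    rintro p q e ⟨⟨he, hq⟩, hr⟩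
    refine ⟨⟨(Equiv.swap p q).injective.comp he, fun i h => hq i ?_⟩, ?_⟩
    · rw [Function.comp_apply, Equiv.swap_apply_eq_iff, Equiv.swap_apply_left] at h
      exact h
    · rw [Function.comp_apply, hr, Equiv.swap_apply_left]
  refine Finset.sum_bij' (fun e _ => Equiv.swap p q ∘ e) (fun e _ => Equiv.swap q p ∘ e)
    ?_ ?_ ?_ ?_ ?_
  · intro e he
    exact Finset.mem_filter.mpr ⟨Finset.mem_univ _, hswap p q e (Finset.mem_filter.mp he).2⟩
  · intro e he
    exact Finset.mem_filter.mpr ⟨Finset.mem_univ _, hswap q p e (Finset.mem_filter.mp he).2⟩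
  · intro e _
    funext i
    simp [Equiv.swap_comm q p]
  · intro e _
    funext i
    simp [Equiv.swap_comm q p]
  · intro e he
    obtain ⟨⟨he, hq⟩, hr⟩ := (Finset.mem_filter.mp he).2
    refine Finset.prod_congr rfl fun i hi => ?_
    have hp : e i ≠ p := fun h => Finset.ne_of_mem_erase hi (he (h.trans hr.symm))
    rw [Function.comp_apply, Equiv.swap_apply_of_ne_of_ne hp (hq i)]

/-- Laplace expansion of `P_q` along row `r`. -/
theorem sum_row_X_mul_Bpd (k : Type*) [Field k] (d : ℕ) (r : Fin d) (q : Fin (d + 1)) :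
    ∑ p, X (r, p) * Bpd k d r p q = Pq k d q := by
  simp only [X_mul_Bpd]
  rw [Finset.sum_comm, Pq_eq_sum_injective]
  simp

/-- Laplace expansion of `P_q` along column `p`. -/
theorem sum_col_X_mul_Bpd (k : Type*) [Field k] (d : ℕ) {p q : Fin (d + 1)} (hpq : p ≠ q) :
    ∑ r, X (r, p) * Bpd k d r p q = Pq k d q := by
  simp only [X_mul_Bpd]
  rw [Finset.sum_comm, Pq_eq_sum_injective]
  refine Finset.sum_congr rfl fun e he => ?_
  obtain ⟨he, hq⟩ := (Finset.mem_filter.mp he).2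
  obtain ⟨r, hr⟩ : ∃ r, e r = p := by
    choose f hf using fun i => Fin.exists_succAbove_eq (hq i)
    have hinj : Function.Injective f := fun a b hab => he (by rw [← hf a, ← hf b, hab])
    obtain ⟨s, rfl⟩ := Fin.exists_succAbove_eq hpq
    obtain ⟨r, rfl⟩ := Finite.surjective_of_injective hinj s
    exact ⟨r, (hf r).symm⟩
  have hiff : ∀ i, e i = p ↔ r = i := fun i =>
    ⟨fun h => he (hr.trans h.symm), fun h => h ▸ hr⟩
  simp [hiff]

theorem Pq_mem_permIdeal (k : Type*) [Field k] (d : ℕ) (q : Fin (d + 1)) :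
    Pq k d q ∈ permIdeal k d d (d + 1) :=
  Ideal.subset_span ⟨id, q.succAbove, strictMono_id, Fin.strictMono_succAbove q, rfl⟩

theorem stmt9 (k : Type*) [Field k] (d : ℕ) (i : Fin d) (j : Fin (d + 1)) :
    X (i, j) * fp k d j ∈ permIdeal k d d (d + 1) ∧
      X (i, j) * gr k d i ∈ permIdeal k d d (d + 1) := by
  constructor
  · refine mul_det_mem_of_vecMul_mem _ _ (fun r => X (r, j)) (fun s => ?_) i
    have h := sum_col_X_mul_Bpd k d (Fin.succAbove_ne j s).symm
    simp only [Bpd_symm k d _ j] at h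
    have hmem := Pq_mem_permIdeal k d (j.succAbove s)
    rw [← h] at hmem
    exact hmem
  · refine mul_det_mem_of_vecMul_mem _ _ (fun p => X (i, p)) (fun q => ?_) j
    have hmem := Pq_mem_permIdeal k d q
    rw [← sum_row_X_mul_Bpd k d i q] at hmem
    exact hmem
end

section
/- Let k be a field and let M = (x_{i,j}) be the generic m×n matrix over k. Suppose m_1 ≤ m, n_1 ≤ n, d_1 ≤ d ≤ min(m,n), and d - d_1 ≥ (m + n) - (m_1 + n_1). Fix any m_1-element set R of rows and any n_1-element set C of columns of M, and let I_{d_1}(m_1,n_1) be the ideal generated by the permanents of all d_1×d_1 submatrices of the m_1×n_1 submatrix of M with rows R and columns C. Then I_{d_1}(m_1,n_1) ⊇ I_d(m,n). -/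
open MvPolynomial

/-- The ideal generated by the permanents of all `d₁ × d₁` submatrices of the submatrix of
the generic `m × n` matrix with rows `R` and columns `C`. -/
noncomputable def permIdealSub (k : Type*) [Field k] (d₁ m n : ℕ)
    (R : Finset (Fin m)) (C : Finset (Fin n)) :
    Ideal (MvPolynomial (Fin m × Fin n) k) :=
  Ideal.span {p | ∃ (r : Fin d₁ → Fin m) (c : Fin d₁ → Fin n), StrictMono r ∧ StrictMono c ∧
    (∀ i, r i ∈ R) ∧ (∀ j, c j ∈ C) ∧
    p = Matrix.permanent (Matrix.of fun i j => X (r i, c j))}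

open Matrix

/-- Expansion of a permanent along column `j`. -/
theorem Matrix.permanent_succ_column {A : Type*} [CommRing A] {e : ℕ}
    (M : Matrix (Fin (e + 1)) (Fin (e + 1)) A) (j : Fin (e + 1)) :
    M.permanent = ∑ p, M p j *
      (M.submatrix (Equiv.swap 0 p ∘ Fin.succ) (Equiv.swap 0 j ∘ Fin.succ)).permanent := by
  rw [← permanent_permute_rows (Equiv.swap 0 j) M, permanent,
    ← Equiv.Perm.decomposeFin.symm.sum_comp, Fintype.sum_prod_type]
  simp [permanent, Finset.mul_sum, Fin.prod_univ_succ]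

/-- Expansion of a permanent along row `i`. -/
theorem Matrix.permanent_succ_row {A : Type*} [CommRing A] {e : ℕ}
    (M : Matrix (Fin (e + 1)) (Fin (e + 1)) A) (i : Fin (e + 1)) :
    M.permanent = ∑ p, M i p *
      (M.submatrix (Equiv.swap 0 i ∘ Fin.succ) (Equiv.swap 0 p ∘ Fin.succ)).permanent := by
  rw [← permanent_transpose, permanent_succ_column Mᵀ i]
  refine Finset.sum_congr rfl fun p _ => ?_
  rw [← permanent_transpose, transpose_submatrix, transpose_transpose, transpose_apply]

theorem swap_comp_succ_injective {e : ℕ} (p : Fin (e + 1)) :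
    Function.Injective (Equiv.swap 0 p ∘ Fin.succ) :=
  (Equiv.swap 0 p).injective.comp (Fin.succ_injective e)

theorem swap_comp_succ_ne {e : ℕ} (p : Fin (e + 1)) (i : Fin e) :
    (Equiv.swap 0 p ∘ Fin.succ) i ≠ p := by
  rw [Function.comp_apply, Ne, Equiv.swap_apply_eq_iff, Equiv.swap_apply_right]
  exact Fin.succ_ne_zero i

theorem card_filter_comp_le {ι κ : Type*} [Fintype ι] [Fintype κ] {f : ι → κ}
    (hf : f.Injective) (P : κ → Prop) [DecidablePred P] :
    (Finset.univ.filter fun i => P (f i)).card ≤ (Finset.univ.filter P).card :=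
  Finset.card_le_card_of_injOn f (fun i hi => by simpa using hi) hf.injOn

theorem card_filter_comp_lt {ι κ : Type*} [Fintype ι] [Fintype κ] {f : ι → κ}
    (hf : f.Injective) (P : κ → Prop) [DecidablePred P] {a : κ} (ha : P a)
    (hfa : ∀ i, f i ≠ a) :
    (Finset.univ.filter fun i => P (f i)).card < (Finset.univ.filter P).card := by
  classical
  rw [← Finset.card_image_of_injective _ hf]
  refine Finset.card_lt_card (Finset.ssubset_iff_of_subset ?_ |>.2 ⟨a, by simpa using ha, ?_⟩)
  · intro b hb
    obtain ⟨i, hi, rfl⟩ := Finset.mem_image.1 hb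
    simpa using hi
  · simp [hfa]

theorem permanent_mem_permIdealSub {k : Type*} [Field k] {d₁ m n : ℕ}
    {R : Finset (Fin m)} {C : Finset (Fin n)} {r : Fin d₁ → Fin m} {c : Fin d₁ → Fin n}
    (hr : r.Injective) (hc : c.Injective) (hrR : ∀ i, r i ∈ R) (hcC : ∀ j, c j ∈ C) :
    permanent (of fun i j => (X (r i, c j) : MvPolynomial (Fin m × Fin n) k)) ∈
      permIdealSub k d₁ m n R C := by
  rw [← permanent_permute_rows (Tuple.sort c), ← permanent_permute_cols (Tuple.sort r)]
  exact Ideal.subset_span ⟨r ∘ Tuple.sort r, c ∘ Tuple.sort c,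
    (Tuple.monotone_sort r).strictMono_of_injective (hr.comp (Tuple.sort r).injective),
    (Tuple.monotone_sort c).strictMono_of_injective (hc.comp (Tuple.sort c).injective),
    fun i => hrR _, fun j => hcC _, rfl⟩

/-- A `d × d` subpermanent lies in `permIdealSub k d₁ m n R C` as soon as `d` exceeds `d₁` by at
least the number of its rows outside `R` plus the number of its columns outside `C`. -/
theorem permanent_mem_permIdealSub_of_card_le {k : Type*} [Field k] {d₁ m n : ℕ}
    {R : Finset (Fin m)} {C : Finset (Fin n)} {d : ℕ} {r : Fin d → Fin m} {c : Fin d → Fin n}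
    (hr : r.Injective) (hc : c.Injective)
    (h : (Finset.univ.filter fun i => r i ∉ R).card +
      (Finset.univ.filter fun j => c j ∉ C).card + d₁ ≤ d) :
    permanent (of fun i j => (X (r i, c j) : MvPolynomial (Fin m × Fin n) k)) ∈
      permIdealSub k d₁ m n R C := by
  induction d with
  | zero =>
    obtain rfl : d₁ = 0 := by omega
    exact permanent_mem_permIdealSub hr hc (fun i => i.elim0) fun j => j.elim0
  | succ e ih =>
    have hminor (i j : Fin (e + 1))
        (hij : (Finset.univ.filter fun a => r ((Equiv.swap 0 i ∘ Fin.succ) a) ∉ R).card +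
          (Finset.univ.filter fun b => c ((Equiv.swap 0 j ∘ Fin.succ) b) ∉ C).card + d₁ ≤ e) :=
      ih (hr.comp (swap_comp_succ_injective i)) (hc.comp (swap_comp_succ_injective j)) hij
    have hrow (i : Fin (e + 1)) :=
      card_filter_comp_le (swap_comp_succ_injective i) fun a => r a ∉ R
    have hcol (j : Fin (e + 1)) :=
      card_filter_comp_le (swap_comp_succ_injective j) fun b => c b ∉ C
    by_cases hcC : ∃ j, c j ∉ C
    · obtain ⟨j, hj⟩ := hcC
      have hlt := card_filter_comp_lt (swap_comp_succ_injective j) (fun b => c b ∉ C) hj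
        (swap_comp_succ_ne j)
      rw [permanent_succ_column _ j]
      refine Ideal.sum_mem _ fun i _ => Ideal.mul_mem_left _ _ (hminor i j ?_)
      have := hrow i
      omega
    by_cases hrR : ∃ i, r i ∉ R
    · obtain ⟨i, hi⟩ := hrR
      have hlt := card_filter_comp_lt (swap_comp_succ_injective i) (fun a => r a ∉ R) hi
        (swap_comp_succ_ne i)
      rw [permanent_succ_row _ i]
      refine Ideal.sum_mem _ fun j _ => Ideal.mul_mem_left _ _ (hminor i j ?_)
      have := hcol j
      omega
    push Not at hcC hrR
    obtain rfl | hlt := (show d₁ ≤ e + 1 by omega).eq_or_lt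
    · exact permanent_mem_permIdealSub hr hc hrR hcC
    · rw [permanent_succ_column _ 0]
      refine Ideal.sum_mem _ fun i _ => Ideal.mul_mem_left _ _ (hminor i 0 ?_)
      simp only [hrR, hcC, not_true_eq_false, Finset.filter_false, Finset.card_empty]
      omega

theorem stmt11 (k : Type*) [Field k] (d m n d₁ m₁ n₁ : ℕ)
    (hdm : d ≤ m) (hdn : d ≤ n) (hm : m₁ ≤ m) (hn : n₁ ≤ n) (hd : d₁ ≤ d)
    (h : (m + n) - (m₁ + n₁) ≤ d - d₁)
    (R : Finset (Fin m)) (hR : R.card = m₁) (C : Finset (Fin n)) (hC : C.card = n₁) :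
    permIdeal k d m n ≤ permIdealSub k d₁ m n R C := by
  refine Ideal.span_le.2 ?_
  rintro _ ⟨r, c, hr, hc, rfl⟩
  refine permanent_mem_permIdealSub_of_card_le hr.injective hc.injective ?_
  have hrow := card_filter_comp_le hr.injective (· ∉ R)
  have hcol := card_filter_comp_le hc.injective (· ∉ C)
  rw [show Finset.univ.filter (· ∉ R) = Rᶜ by ext; simp, Finset.card_compl,
    Fintype.card_fin] at hrow
  rw [show Finset.univ.filter (· ∉ C) = Cᶜ by ext; simp, Finset.card_compl,
    Fintype.card_fin] at hcol
  omega
end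

section
/- Fix a field k, integers d ≤ m, n, and a weakly decreasing finite sequence v = (v_1 ≥ … ≥ v_l) of positive integers with s(v) = v_1 + … + v_l ≤ min(m,n) and d'(v) = s(v) - l + 1 ≤ d. Let 𝔭 be a prime of type v for the generic m×n matrix M = (x_{i,j}); that is: choose a submatrix M' of M of size m'×n' with m' + n' = m + n - (d - d'(v)), choose pairwise disjoint sets R_1, …, R_l of rows of M' with |R_i| = v_i and pairwise disjoint sets C_1, …, C_l of columns of M' with |C_i| = v_i, let a_i be the permanent of the v_i×v_i submatrix of M' with rows R_i and columns C_i, and let 𝔭 be the ideal generated by a_1, …, a_l together with all entries of M' not lying in any of these v_i×v_i blocks. Then 𝔭 contains I_d(m,n). -/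
open MvPolynomial

open Equiv in
/-- The permanent is invariant under independent reindexing of rows and columns. -/
theorem Matrix.permanent_submatrix_equiv {R α β : Type*} [CommRing R] [Fintype α] [DecidableEq α]
    [Fintype β] [DecidableEq β] (e₁ e₂ : α ≃ β) (A : Matrix β β R) :
    (A.submatrix e₁ e₂).permanent = A.permanent := by
  unfold Matrix.permanent
  refine Fintype.sum_equiv (Equiv.equivCongr e₂ e₁) _ _ fun σ => ?_
  exact Fintype.prod_equiv e₂ _ _ fun i => by simp

open Equiv in
/-- A partial permanent expansion over a set of permutations that is stable under permuting the
columns satisfying `p` lies in any ideal containing the corresponding subpermanents. -/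
theorem sum_prod_mem_of_permanent_mem {R α : Type*} [CommRing R] [Fintype α] [DecidableEq α]
    (I : Ideal R) (M : Matrix α α R) (p : α → Prop) [DecidablePred p] (S : Finset (Perm α))
    (hS : ∀ σ ∈ S, ∀ τ : Perm (Subtype p), σ * Perm.ofSubtype τ ∈ S)
    (hI : ∀ σ ∈ S,
      Matrix.permanent (Matrix.of fun a b : Subtype p => M (σ a) b) ∈ I) :
    ∑ σ ∈ S, ∏ j, M (σ j) j ∈ I := by
  classical
  let H : Subgroup (Perm α) := (Perm.ofSubtype : Perm (Subtype p) →* Perm α).range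
  rw [← Finset.sum_fiberwise S (fun σ => (QuotientGroup.mk σ : Perm α ⧸ H))]
  refine Ideal.sum_mem _ fun q _ => ?_
  by_cases hq : ∃ σ ∈ S, (QuotientGroup.mk σ : Perm α ⧸ H) = q
  swap
  · rw [Finset.sum_eq_zero]
    · exact I.zero_mem
    · intro σ hσ
      rw [Finset.mem_filter] at hσ
      exact absurd ⟨σ, hσ⟩ hq
  obtain ⟨σ, hσ, rfl⟩ := hq
  have himage : {x ∈ S | (QuotientGroup.mk x : Perm α ⧸ H) = QuotientGroup.mk σ} =
      Finset.univ.image fun τ : Perm (Subtype p) => σ * Perm.ofSubtype τ := by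
    ext x
    simp only [Finset.mem_filter, Finset.mem_image, Finset.mem_univ, true_and]
    constructor
    · rintro ⟨-, hx⟩
      obtain ⟨τ, hτ⟩ := QuotientGroup.eq.mp hx.symm
      exact ⟨τ, by rw [hτ]; simp⟩
    · rintro ⟨τ, rfl⟩
      refine ⟨hS σ hσ τ, (QuotientGroup.eq.mpr (?_ : _ ∈ H)).symm⟩
      exact ⟨τ, by simp⟩
  rw [himage, Finset.sum_image fun τ _ τ' _ h => Perm.ofSubtype_injective (mul_left_cancel h)]
  have hprod : ∀ τ : Perm (Subtype p),
      ∏ j, M ((σ * Perm.ofSubtype τ) j) j =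
        (∏ b : Subtype p, M (σ (τ b)) b) * ∏ b : {x // ¬ p x}, M (σ b) b := by
    intro τ
    rw [← Fintype.prod_subtype_mul_prod_subtype p]
    congr 1
    · exact Finset.prod_congr rfl fun b _ => by simp
    · exact Finset.prod_congr rfl fun b _ => by simp [Perm.ofSubtype_apply_of_not_mem τ b.2]
  simp only [hprod]
  rw [← Finset.sum_mul]
  exact I.mul_mem_right _ (hI σ hσ)

open Equiv in
/-- If the properties `F b` of permutations are stable under permuting the columns in each
`P b`, and the subpermanents of the blocks are in `I`, it suffices to look at permutations that
have none of the properties. -/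
theorem permanent_mem_of_block_mem {R α β : Type*} [CommRing R] [Fintype α] [DecidableEq α]
    [Fintype β] (I : Ideal R) (M : Matrix α α R) (P : β → α → Prop) [∀ b, DecidablePred (P b)]
    (F : β → Perm α → Prop)
    (hF : ∀ b b' σ (τ : Perm (Subtype (P b))),
      F b σ → (F b' (σ * Perm.ofSubtype τ) ↔ F b' σ))
    (hI : ∀ b σ, F b σ →
      Matrix.permanent (Matrix.of fun x y : Subtype (P b) => M (σ x) y) ∈ I)
    (hrest : ∀ σ, (∀ b, ¬ F b σ) → ∏ j, M (σ j) j ∈ I) :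
    M.permanent ∈ I := by
  classical
  have key : ∀ T : Finset β, ∑ σ with (∀ b ∈ T, ¬ F b σ), ∏ j, M (σ j) j ∈ I →
      M.permanent ∈ I := by
    intro T
    induction T using Finset.induction_on with
    | empty => intro h; simpa [Matrix.permanent] using h
    | insert b T _ ih =>
      intro h
      apply ih
      rw [← Finset.sum_filter_add_sum_filter_not _ (F b)]
      refine I.add_mem (sum_prod_mem_of_permanent_mem I M (P b) _ ?_ ?_) ?_
      · intro σ hσ τ
        simp only [Finset.mem_filter, Finset.mem_univ, true_and] at hσ ⊢
        exact ⟨fun b' hb' => (hF b b' σ τ hσ.2).not.mpr (hσ.1 b' hb'),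
          (hF b b σ τ hσ.2).mpr hσ.2⟩
      · intro σ hσ
        exact hI b σ (Finset.mem_filter.mp hσ).2
      · convert h using 2
        ext σ
        simp only [Finset.mem_filter, Finset.mem_univ, true_and, Finset.forall_mem_insert]
        exact and_comm
  refine key Finset.univ (Ideal.sum_mem _ fun σ hσ => hrest σ ?_)
  simpa using hσ

open Equiv in
/-- A permutation with enough entries inside `R' × C'`, all of them in the diagonal blocks
`Rb b × Cb b`, fills one of the blocks. -/
theorem exists_block_filled {d m n l : ℕ} (v : Fin l → ℕ)
    (hd' : (∑ i, v i) - l + 1 ≤ d)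
    (R' : Finset (Fin m)) (C' : Finset (Fin n))
    (hsize : R'.card + C'.card = m + n - (d - ((∑ i, v i) - l + 1)))
    (Rb : Fin l → Finset (Fin m)) (Cb : Fin l → Finset (Fin n))
    (hCcard : ∀ i, (Cb i).card = v i)
    (r : Fin d → Fin m) (c : Fin d → Fin n) (hr : Function.Injective r)
    (hc : Function.Injective c) (σ : Perm (Fin d))
    (hσ : ∀ j, r (σ j) ∈ R' → c j ∈ C' → ∃ b, r (σ j) ∈ Rb b ∧ c j ∈ Cb b) :
    ∃ b, ∀ x ∈ Cb b, ∃ j, c j = x ∧ r (σ j) ∈ Rb b := by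
  by_contra! hnot
  let J : Finset (Fin d) := {j | r (σ j) ∈ R' ∧ c j ∈ C'}
  let Jb : Fin l → Finset (Fin d) := fun b => {j | r (σ j) ∈ Rb b ∧ c j ∈ Cb b}
  have hJb : ∀ b, (Jb b).card + 1 ≤ v b := by
    intro b
    obtain ⟨x, hx, hxj⟩ := hnot b
    rw [← hCcard b, ← Finset.card_image_of_injective _ hc]
    refine Finset.card_lt_card ⟨?_, fun h => ?_⟩
    · intro y hy
      obtain ⟨j, hj, rfl⟩ := Finset.mem_image.mp hy
      exact (Finset.mem_filter.mp hj).2.2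
    · obtain ⟨j, hj, hjx⟩ := Finset.mem_image.mp (h hx)
      exact hxj j hjx (Finset.mem_filter.mp hj).2.1
  have hJsub : J ⊆ Finset.univ.biUnion Jb := by
    intro j hj
    obtain ⟨h1, h2⟩ := (Finset.mem_filter.mp hj).2
    obtain ⟨b, hb⟩ := hσ j h1 h2
    exact Finset.mem_biUnion.mpr ⟨b, Finset.mem_univ _,
      Finset.mem_filter.mpr ⟨Finset.mem_univ _, hb⟩⟩
  have hJ : J.card ≤ ∑ b, (Jb b).card :=
    (Finset.card_le_card hJsub).trans Finset.card_biUnion_le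
  have hsum : ∑ b, (Jb b).card + l ≤ ∑ b, v b := by
    calc ∑ b, (Jb b).card + l = ∑ b, ((Jb b).card + 1) := by simp [Finset.sum_add_distrib]
      _ ≤ _ := Finset.sum_le_sum fun b _ => hJb b
  have hrows : (Finset.univ.filter fun j => r (σ j) ∉ R').card ≤ m - R'.card := by
    calc _ ≤ (R'ᶜ).card := Finset.card_le_card_of_injOn (fun j => r (σ j)) (by
          intro j hj; simpa using hj) (hr.comp σ.injective).injOn
      _ = _ := by simp [Finset.card_compl]
  have hcols : (Finset.univ.filter fun j => c j ∉ C').card ≤ n - C'.card := by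
    calc _ ≤ (C'ᶜ).card := Finset.card_le_card_of_injOn c (by
          intro j hj; simpa using hj) hc.injOn
      _ = _ := by simp [Finset.card_compl]
  have hcover : d ≤ J.card + ((Finset.univ.filter fun j => r (σ j) ∉ R').card +
      (Finset.univ.filter fun j => c j ∉ C').card) := by
    calc d = (Finset.univ : Finset (Fin d)).card := by simp
      _ ≤ (J ∪ ((Finset.univ.filter fun j => r (σ j) ∉ R') ∪
            (Finset.univ.filter fun j => c j ∉ C'))).card := Finset.card_le_card fun j _ => by
          simp only [J, Finset.mem_union, Finset.mem_filter, Finset.mem_univ, true_and]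
          tauto
      _ ≤ _ := (Finset.card_union_le _ _).trans
          (Nat.add_le_add_left (Finset.card_union_le _ _) _)
  have hR' : R'.card ≤ m := by simpa using R'.card_le_univ
  have hC' : C'.card ≤ n := by simpa using C'.card_le_univ
  omega

open Equiv in
/-- If `σ` fills the block `Rb × Cb`, the subpermanent of the matrix `X (r i, c j)` cut out by the
columns in `Cb` and their images under `σ` is the permanent of the block. -/
theorem permanent_filled_block {R : Type*} [CommRing R] {d m n w : ℕ} (A : Fin m → Fin n → R)
    (Rb : Finset (Fin m)) (Cb : Finset (Fin n)) (hR : Rb.card = w) (hC : Cb.card = w)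
    (r : Fin d → Fin m) (c : Fin d → Fin n) (hr : Function.Injective r)
    (hc : Function.Injective c) (σ : Perm (Fin d))
    (hσ : ∀ x ∈ Cb, ∃ j, c j = x ∧ r (σ j) ∈ Rb) :
    Matrix.permanent (Matrix.of fun x y : {j // c j ∈ Cb} => A (r (σ x)) (c y)) =
      Matrix.permanent (Matrix.of fun a b : Fin w =>
        A (Rb.orderIsoOfFin hR a) (Cb.orderIsoOfFin hC b)) := by
  have hmem : ∀ j : {j // c j ∈ Cb}, r (σ j) ∈ Rb := by
    rintro ⟨j, hj⟩
    obtain ⟨i, hi, hri⟩ := hσ _ hj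
    exact hc hi ▸ hri
  let f : {j // c j ∈ Cb} → Cb := fun j => ⟨c j, j.2⟩
  have hf : Function.Bijective f := by
    refine ⟨fun i j h => Subtype.ext (hc (congrArg Subtype.val h)), ?_⟩
    rintro ⟨x, hx⟩
    obtain ⟨j, rfl, -⟩ := hσ x hx
    exact ⟨⟨j, hx⟩, rfl⟩
  let g : {j // c j ∈ Cb} → Rb := fun j => ⟨r (σ j), hmem j⟩
  have hg : Function.Bijective g := by
    refine (Fintype.bijective_iff_injective_and_card g).mpr
      ⟨fun i j h => Subtype.ext (σ.injective (hr (congrArg Subtype.val h))), ?_⟩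
    rw [Fintype.card_of_bijective hf]
    simp [hR, hC]
  rw [← Matrix.permanent_submatrix_equiv
    ((Equiv.ofBijective g hg).trans (Rb.orderIsoOfFin hR).symm.toEquiv)
    ((Equiv.ofBijective f hf).trans (Cb.orderIsoOfFin hC).symm.toEquiv)]
  congr 1
  ext x y
  simp only [Matrix.of_apply, Matrix.submatrix_apply, Equiv.trans_apply, RelIso.coe_fn_toEquiv,
    Equiv.ofBijective_apply, OrderIso.apply_symm_apply, f, g]

/-- A prime of type `v` (given by the block data below) contains `I_d(m,n)`. -/
theorem stmt12 (k : Type*) [Field k] (d m n l : ℕ) (hdm : d ≤ m) (hdn : d ≤ n)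
    (v : Fin l → ℕ) (hdec : Antitone v) (hpos : ∀ i, 0 < v i)
    (hsm : ∑ i, v i ≤ m) (hsn : ∑ i, v i ≤ n)
    (hd' : (∑ i, v i) - l + 1 ≤ d)
    -- the submatrix M' of M, of size m' × n' with m' + n' = m + n - (d - d'(v))
    (R' : Finset (Fin m)) (C' : Finset (Fin n))
    (hsize : R'.card + C'.card = m + n - (d - ((∑ i, v i) - l + 1)))
    -- the pairwise disjoint row blocks and column blocks
    (Rb : Fin l → Finset (Fin m)) (Cb : Fin l → Finset (Fin n))
    (hRsub : ∀ i, Rb i ⊆ R') (hCsub : ∀ i, Cb i ⊆ C')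
    (hRcard : ∀ i, (Rb i).card = v i) (hCcard : ∀ i, (Cb i).card = v i)
    (hRdisj : ∀ i j, i ≠ j → Disjoint (Rb i) (Rb j))
    (hCdisj : ∀ i j, i ≠ j → Disjoint (Cb i) (Cb j))
    (𝔭 : Ideal (MvPolynomial (Fin m × Fin n) k)) (hprime : 𝔭.IsPrime)
    (h𝔭 : 𝔭 = Ideal.span
      ({p | ∃ i : Fin l, p = Matrix.permanent (Matrix.of fun (a b : Fin (v i)) =>
          X (((Rb i).orderIsoOfFin (hRcard i) a : Fin m),
             ((Cb i).orderIsoOfFin (hCcard i) b : Fin n)))} ∪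
       {p | ∃ (r : Fin m) (c : Fin n), r ∈ R' ∧ c ∈ C' ∧
          (¬ ∃ i, r ∈ Rb i ∧ c ∈ Cb i) ∧ p = X (r, c)})) :
    permIdeal k d m n ≤ 𝔭 := by
  classical
  rw [permIdeal, Ideal.span_le]
  rintro _ ⟨r, c, hr, hc, rfl⟩
  refine permanent_mem_of_block_mem 𝔭 _ (fun b j => c j ∈ Cb b)
    (fun b σ => ∀ x ∈ Cb b, ∃ j, c j = x ∧ r (σ j) ∈ Rb b) ?_ ?_ ?_
  · intro b b' σ τ hσ
    by_cases hb : b' = b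
    · subst hb
      refine iff_of_true (fun x hx => ?_) hσ
      obtain ⟨j, rfl, -⟩ := hσ x hx
      obtain ⟨i, hi, hri⟩ := hσ _ (τ ⟨j, hx⟩).2
      refine ⟨j, rfl, ?_⟩
      rw [Equiv.Perm.mul_apply, Equiv.Perm.ofSubtype_apply_of_mem τ hx, ← hc.injective hi]
      exact hri
    · refine forall₂_congr fun x hx => exists_congr fun j => and_congr_right fun hj => ?_
      rw [Equiv.Perm.mul_apply, Equiv.Perm.ofSubtype_apply_of_not_mem]
      subst hj
      exact Finset.disjoint_left.mp (hCdisj b' b hb) hx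
  · intro b σ hσ
    have h := permanent_filled_block (fun i j => (X (i, j) : MvPolynomial (Fin m × Fin n) k))
      (Rb b) (Cb b) (hRcard b) (hCcard b) r c hr.injective hc.injective σ hσ
    simp only [Matrix.of_apply]
    rw [h, h𝔭]
    exact Ideal.subset_span (Or.inl ⟨b, rfl⟩)
  · intro σ hσ
    have hcell : ∃ j, r (σ j) ∈ R' ∧ c j ∈ C' ∧ ¬ ∃ b, r (σ j) ∈ Rb b ∧ c j ∈ Cb b := by
      by_contra! h
      obtain ⟨b, hb⟩ := exists_block_filled v hd' R' C' hsize Rb Cb hCcard r c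
        hr.injective hc.injective σ h
      exact hσ b hb
    obtain ⟨j, hjR, hjC, hj⟩ := hcell
    refine 𝔭.mem_of_dvd (Finset.dvd_prod_of_mem _ (Finset.mem_univ j)) ?_
    rw [h𝔭]
    exact Ideal.subset_span (Or.inr ⟨_, _, hjR, hjC, hj, rfl⟩)
end

section
/- Let k be a field, let A = (a_{i,j}) be a d×n matrix over k, and consider the polynomial P_A(X_1, …, X_n) = ∏_{i=1}^d (∑_{j=1}^n a_{i,j} X_j) in k[X_1, …, X_n]. For α = (α_1, …, α_n) ∈ ℕ^n with α_1 + … + α_n = d, let c_α be the coefficient of the monomial X_1^{α_1} ⋯ X_n^{α_n} in P_A, and let A_α be the d×d matrix whose columns consist of α_j copies of column j of A, for each j. Then the permanent of A_α equals c_α · ∏_{j=1}^n (α_j)!. -/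
open MvPolynomial

/-- If `f` and `g` have fibers of the same sizes, then the number of permutations `σ` with
`g ∘ σ = f` is the product of the factorials of the fiber sizes. -/
theorem card_perm_comp_eq {ι κ : Type*} [Fintype ι] [DecidableEq ι] [Fintype κ] [DecidableEq κ]
    (f g : ι → κ)
    (h : ∀ j, (Finset.univ.filter fun c => f c = j).card =
      (Finset.univ.filter fun c => g c = j).card) :
    (Finset.univ.filter fun σ : Equiv.Perm ι => g ∘ σ = f).card =
      ∏ j, ((Finset.univ.filter fun c => g c = j).card).factorial := by
  have e : ∀ j, Nonempty ({c // f c = j} ≃ {c // g c = j}) := fun j =>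
    ⟨Fintype.equivOfCardEq (by simpa only [Fintype.card_subtype] using h j)⟩
  let τ : Equiv.Perm ι := Equiv.ofFiberEquiv fun j => (e j).some
  have hτ : ∀ c, g (τ c) = f c := fun c => Equiv.ofFiberEquiv_map _ c
  have key := DomMulAct.stabilizer_card g
  simp only [Fintype.card_subtype] at key
  rw [← key]
  refine Finset.card_bij' (fun σ _ => σ * τ⁻¹) (fun σ _ => σ * τ) ?_ ?_ ?_ ?_
  · intro σ hσ
    simp only [Finset.mem_filter, Finset.mem_univ, true_and] at hσ ⊢
    funext c
    have h1 := congrFun hσ (τ⁻¹ c)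
    have h2 := hτ (τ⁻¹ c)
    simp_all
  · intro σ hσ
    simp only [Finset.mem_filter, Finset.mem_univ, true_and] at hσ ⊢
    funext c
    have h1 := congrFun hσ (τ c)
    simp_all
  · intro σ _
    simp
  · intro σ _
    simp

/-- The coefficient of a monomial in a product of linear forms. -/
theorem coeff_prod_linear {R ι κ : Type*} [CommSemiring R] [Fintype ι] [DecidableEq ι]
    [Fintype κ] [DecidableEq κ] (A : Matrix ι κ R) (α : κ → ℕ) :
    coeff (Finsupp.equivFunOnFinite.symm α) (∏ i, ∑ j, C (A i j) * X j) =
      ∑ f : ι → κ, if ∀ j, (Finset.univ.filter fun c => f c = j).card = α j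
        then ∏ i, A i (f i) else 0 := by
  rw [Fintype.prod_sum, coeff_sum]
  refine Finset.sum_congr rfl fun f _ => ?_
  have hX : (∏ i, (X (f i) : MvPolynomial κ R)) =
      monomial (∑ i, Finsupp.single (f i) 1) 1 := by
    rw [monomial_sum_one]
    rfl
  rw [Finset.prod_mul_distrib, ← map_prod, coeff_C_mul, hX, coeff_monomial]
  have hiff : (∑ i, Finsupp.single (f i) 1 = Finsupp.equivFunOnFinite.symm α) ↔
      ∀ j, (Finset.univ.filter fun c => f c = j).card = α j := by
    rw [Finsupp.ext_iff]
    refine forall_congr' fun j => ?_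
    simp [Finsupp.finsetSum_apply, Finsupp.single_apply]
  simp only [hiff, mul_ite, mul_one, mul_zero]

/-- Claim 1 of Alon–Tarsi: if `P_A = ∏_i (∑_j a_{i,j} X_j)`, `α ∈ ℕ^n` has `∑ α_j = d`,
`c_α` is the coefficient of `X_1^{α_1} ⋯ X_n^{α_n}` in `P_A`, and `A_α` is the `d × d`
matrix whose columns consist of `α_j` copies of column `j` of `A` (realized by any
function `g` taking each value `j` exactly `α_j` times), then
`perm (A_α) = c_α · ∏_j (α_j)!`. -/
theorem stmt15 (k : Type*) [Field k] (d n : ℕ) (A : Matrix (Fin d) (Fin n) k)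
    (α : Fin n → ℕ) (hα : ∑ j, α j = d)
    (g : Fin d → Fin n) (hg : ∀ j, (Finset.univ.filter fun c => g c = j).card = α j) :
    Matrix.permanent (Matrix.of fun i c => A i (g c)) =
      MvPolynomial.coeff (Finsupp.equivFunOnFinite.symm α)
          (∏ i : Fin d, ∑ j : Fin n, MvPolynomial.C (A i j) * X j) *
        ↑(∏ j, (α j).factorial) := by
  rw [coeff_prod_linear, Finset.sum_mul, ← Matrix.permanent_transpose, Matrix.permanent]
  simp only [Matrix.transpose_apply, Matrix.of_apply]
  rw [← Finset.sum_fiberwise Finset.univ (fun σ : Equiv.Perm (Fin d) => g ∘ σ)]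
  refine Finset.sum_congr rfl fun f _ => ?_
  have hsum : ∀ σ ∈ Finset.univ.filter (fun σ : Equiv.Perm (Fin d) => g ∘ σ = f),
      ∏ i, A i (g (σ i)) = ∏ i, A i (f i) := by
    intro σ hσ
    rw [← (Finset.mem_filter.mp hσ).2]
    rfl
  rw [Finset.sum_congr rfl hsum, Finset.sum_const, nsmul_eq_mul]
  split_ifs with hf
  · rw [card_perm_comp_eq f g fun j => (hf j).trans (hg j).symm, mul_comm]
    simp only [hg]
  · rw [Finset.card_eq_zero.mpr, Nat.cast_zero, zero_mul, zero_mul]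
    refine Finset.filter_eq_empty_iff.mpr fun σ _ hσ => hf fun j => ?_
    rw [← hg j, ← hσ]
    exact Finset.card_equiv σ (by simp)
end

section
/- Let k be a field with char k = 3, let M = (x_{i,j}) be the generic d×d matrix over k, and let I_d be the ideal of k[x_{i,j}] generated by the permanents of all d×d submatrices of the d×2d matrix (M | M) obtained by placing two copies of M side by side. For 1 ≤ i ≤ d, let M_i be the i×d submatrix of M consisting of its first i rows, and let D_i(M_i) be the ideal generated by the i×i minors of M_i. Then the product of ideals D_1(M_1) · D_2(M_2) ⋯ D_d(M_d) is contained in I_d. -/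
open MvPolynomial

/-- The column `j` of the `d × 2d` matrix `(M | M)`, as a column of `M`. -/
def dblCol (d : ℕ) (j : Fin (2 * d)) : Fin d :=
  if h : (j : ℕ) < d then ⟨j, h⟩ else ⟨(j : ℕ) - d, by have := j.isLt; omega⟩

/-- The ideal generated by the permanents of all `d × d` submatrices of the `d × 2d`
matrix `(M | M)`, where `M` is the generic `d × d` matrix. -/
noncomputable def doubledPermIdeal (k : Type*) [Field k] (d : ℕ) :
    Ideal (MvPolynomial (Fin d × Fin d) k) :=
  Ideal.span {p | ∃ c : Fin d → Fin (2 * d), StrictMono c ∧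
    p = Matrix.permanent (Matrix.of fun i j => X (i, dblCol d (c j)))}

/-- `D_i(M_i)`: the ideal generated by the `i × i` minors of the submatrix of the
generic `d × d` matrix consisting of its first `i` rows (here `i = (t : ℕ) + 1`). -/
noncomputable def minorsFirstRows (k : Type*) [Field k] (d : ℕ) (t : Fin d) :
    Ideal (MvPolynomial (Fin d × Fin d) k) :=
  Ideal.span {p | ∃ c : Fin ((t : ℕ) + 1) → Fin d, StrictMono c ∧
    p = Matrix.det (Matrix.of fun (a b : Fin ((t : ℕ) + 1)) =>
      X (Fin.castLE t.isLt a, c b))}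

namespace Matrix

variable {R : Type*} [CommRing R]

/-- Expansion of the permanent of a product by multilinearity in the columns. -/
theorem permanent_mul_eq_sum {n : Type*} [DecidableEq n] [Fintype n] (M A : Matrix n n R) :
    (M * A).permanent = ∑ f : n → n, (∏ j, A (f j) j) * (M.submatrix id f).permanent := by
  simp only [permanent, mul_apply, Finset.prod_univ_sum, Fintype.piFinset_univ, submatrix_apply,
    id, Finset.mul_sum]
  rw [Finset.sum_comm]
  refine Finset.sum_congr rfl fun f _ => Finset.sum_congr rfl fun σ _ => ?_
  rw [Finset.prod_mul_distrib, mul_comm]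

/-- If `3 = 0`, the permanent of a matrix with three equal columns vanishes. -/
theorem permanent_eq_zero_of_three_cols_eq {n : Type*} [LinearOrder n] [Fintype n]
    (h3 : (3 : R) = 0) (M : Matrix n n R) {a b c : n} (hab : a ≠ b) (hac : a ≠ c) (hbc : b ≠ c)
    (hMab : ∀ i, M i a = M i b) (hMac : ∀ i, M i a = M i c) : M.permanent = 0 := by
  let P : n → Equiv.Perm n → Prop := fun x σ => σ x ≤ σ a ∧ σ x ≤ σ b ∧ σ x ≤ σ c
  let S : n → R := fun x => ∑ σ : Equiv.Perm n, if P x σ then ∏ i, M (σ i) i else 0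
  have hswap (x : n) (hx : ∀ i, M i a = M i x) (σ : Equiv.Perm n) :
      ∏ i, M ((σ * Equiv.swap a x) i) i = ∏ i, M (σ i) i := by
    rw [← Equiv.prod_comp (Equiv.swap a x) fun i => M (σ i) i]
    refine Finset.prod_congr rfl fun i _ => ?_
    rw [Equiv.Perm.mul_apply]
    by_cases h1 : i = a
    · subst h1; simp [hx]
    · by_cases h2 : i = x
      · subst h2; simp [hx]
      · rw [Equiv.swap_apply_of_ne_of_ne h1 h2]
  have hb : S a = S b := by
    refine Fintype.sum_equiv (Equiv.mulRight (Equiv.swap a b)) _ _ fun σ => ?_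
    have hP : P b (σ * Equiv.swap a b) ↔ P a σ := by
      simp only [P, Equiv.Perm.mul_apply, Equiv.swap_apply_left, Equiv.swap_apply_right,
        Equiv.swap_apply_of_ne_of_ne hac.symm hbc.symm]
      tauto
    simp only [Equiv.coe_mulRight, hP, hswap b hMab]
  have hc : S a = S c := by
    refine Fintype.sum_equiv (Equiv.mulRight (Equiv.swap a c)) _ _ fun σ => ?_
    have hP : P c (σ * Equiv.swap a c) ↔ P a σ := by
      simp only [P, Equiv.Perm.mul_apply, Equiv.swap_apply_left, Equiv.swap_apply_right,
        Equiv.swap_apply_of_ne_of_ne hab.symm hbc]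
      tauto
    simp only [Equiv.coe_mulRight, hP, hswap c hMac]
  have hsum : M.permanent = S a + S b + S c := by
    simp only [permanent, S, ← Finset.sum_add_distrib]
    refine Finset.sum_congr rfl fun σ _ => ?_
    have h1 : σ a ≠ σ b := σ.injective.ne hab
    have h2 : σ a ≠ σ c := σ.injective.ne hac
    have h3 : σ b ≠ σ c := σ.injective.ne hbc
    rcases lt_or_gt_of_ne h1 with h1 | h1 <;> rcases lt_or_gt_of_ne h2 with h2 | h2 <;>
      rcases lt_or_gt_of_ne h3 with h3 | h3 <;>
      first
      | exact absurd (h1.trans (h3.trans h2)) (lt_irrefl _)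
      | exact absurd (h2.trans (h3.trans h1)) (lt_irrefl _)
      | simp [P, h1.le, h2.le, h3.le, h1.not_ge, h2.not_ge, h3.not_ge]
  rw [hsum, ← hb, ← hc]
  linear_combination S a * h3

/-- The permanent of a triangular matrix is the product of its diagonal entries. -/
theorem permanent_of_lowerTriangular {d : ℕ} (M : Matrix (Fin d) (Fin d) R)
    (h : ∀ i j, i < j → M i j = 0) : M.permanent = ∏ i, M i i := by
  rw [permanent, Finset.sum_eq_single 1]
  · simp
  · intro σ _ hσ
    by_contra hne
    have hle : ∀ i ∈ (Finset.univ : Finset (Fin d)), (i : ℕ) ≤ (σ i : ℕ) := fun i _ => by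
      by_contra! hlt
      exact hne (Finset.prod_eq_zero (Finset.mem_univ i) (h _ _ hlt))
    have heq := (Finset.sum_eq_sum_iff_of_le hle).mp
      (Equiv.sum_comp σ fun i : Fin d => (i : ℕ)).symm
    exact hσ (Equiv.ext fun i => Fin.ext (heq i (Finset.mem_univ i)).symm)
  · simp

end Matrix

/-- Any `d` columns of the generic matrix in which no column occurs three times can be chosen,
up to reordering, as columns of the doubled matrix. -/
theorem permanent_submatrix_mem_doubledPermIdeal (k : Type*) [Field k] {d : ℕ} (f : Fin d → Fin d)
    (hf : ∀ a b c, a < b → b < c → f a = f b → f b ≠ f c) :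
    ((Matrix.of fun i j => (X (i, j) : MvPolynomial (Fin d × Fin d) k)).submatrix id f).permanent ∈
      doubledPermIdeal k d := by
  classical
  let g : Fin d → Fin (2 * d) := fun a =>
    if ∃ b < a, f b = f a then ⟨f a + d, by omega⟩ else ⟨f a, by omega⟩
  have hg (a : Fin d) : dblCol d (g a) = f a := by
    by_cases h : ∃ b < a, f b = f a <;> simp [g, h, dblCol]
  have hlt (a b : Fin d) (hab : a < b) : g a ≠ g b := by
    intro h
    have hfab : f a = f b := by rw [← hg a, h, hg b]
    have hb : ∃ x < b, f x = f b := ⟨a, hab, hfab⟩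
    by_cases ha : ∃ x < a, f x = f a
    · obtain ⟨x, hx, hxa⟩ := ha
      exact hf x a b hx hab hxa hfab
    · simp only [g, if_pos hb, if_neg ha, Fin.mk.injEq] at h
      have := (f a).isLt
      omega
  have hinj : Function.Injective g := fun a b h => by
    rcases lt_trichotomy a b with hab | hab | hab
    · exact absurd h (hlt a b hab)
    · exact hab
    · exact absurd h.symm (hlt b a hab)
  refine Ideal.subset_span ⟨g ∘ Tuple.sort g,
    (Tuple.monotone_sort g).strictMono_of_injective (hinj.comp (Tuple.sort g).injective), ?_⟩
  rw [← Matrix.permanent_permute_rows (Tuple.sort g)]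
  simp only [Function.comp_apply, hg]
  rfl

/-- In characteristic three, the doubled permanent ideal contains the permanent of every matrix
whose columns are linear combinations of the columns of the generic matrix. -/
theorem permanent_mul_mem_doubledPermIdeal (k : Type*) [Field k] (hchar : ringChar k = 3) {d : ℕ}
    (A : Matrix (Fin d) (Fin d) (MvPolynomial (Fin d × Fin d) k)) :
    ((Matrix.of fun i j => (X (i, j) : MvPolynomial (Fin d × Fin d) k)) * A).permanent ∈
      doubledPermIdeal k d := by
  have h3 : (3 : MvPolynomial (Fin d × Fin d) k) = 0 := by
    have h : (3 : k) = 0 := by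
      have := ringChar.Nat.cast_ringChar (R := k)
      rw [hchar] at this
      exact_mod_cast this
    rw [← map_ofNat (C : k →+* MvPolynomial (Fin d × Fin d) k) 3, h, map_zero]
  rw [Matrix.permanent_mul_eq_sum]
  refine Ideal.sum_mem _ fun f _ => Ideal.mul_mem_left _ _ ?_
  by_cases hf : ∀ a b c, a < b → b < c → f a = f b → f b ≠ f c
  · exact permanent_submatrix_mem_doubledPermIdeal k f hf
  · push Not at hf
    obtain ⟨a, b, c, hab, hbc, hfab, hfbc⟩ := hf
    rw [Matrix.permanent_eq_zero_of_three_cols_eq h3 _ hab.ne (hab.trans hbc).ne hbc.ne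
      (fun i => by simp [hfab]) (fun i => by simp [hfab, hfbc])]
    exact Ideal.zero_mem _

theorem stmt16 (k : Type*) [Field k] (hchar : ringChar k = 3) (d : ℕ) :
    (∏ t : Fin d, minorsFirstRows k d t) ≤ doubledPermIdeal k d := by
  simp only [minorsFirstRows]
  rw [Ideal.prod_span, Ideal.span_le]
  intro p hp
  obtain ⟨m, hm, rfl⟩ := Set.mem_fintype_prod _ _ |>.mp hp
  choose c _ hc using hm
  let N (t : Fin d) : Matrix (Fin (t + 1)) (Fin (t + 1)) (MvPolynomial (Fin d × Fin d) k) :=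
    Matrix.of fun a b => X (Fin.castLE t.isLt a, c t b)
  let G : Matrix (Fin d) (Fin d) (MvPolynomial (Fin d × Fin d) k) := Matrix.of fun i j => X (i, j)
  let A : Matrix (Fin d) (Fin d) (MvPolynomial (Fin d × Fin d) k) :=
    Matrix.of fun l t => ∑ b, if c t b = l then (N t).adjugate b (Fin.last t) else 0
  have hA (t : Fin d) (a : Fin (t + 1)) :
      (G * A) (Fin.castLE t.isLt a) t =
        if a = Fin.last t then m t else 0 := by
    have h := congrFun (congrFun (N t).mul_adjugate a) (Fin.last t)
    rw [Matrix.smul_apply, Matrix.one_apply, smul_eq_mul, mul_ite, mul_one, mul_zero] at h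
    rw [hc t, ← h, Matrix.mul_apply, Matrix.mul_apply]
    simp only [A, Matrix.of_apply, Finset.mul_sum, mul_ite, mul_zero]
    rw [Finset.sum_comm]
    simp [N, G]
  have hperm := Matrix.permanent_of_lowerTriangular (G * A) <| by
    intro i t hit
    have h := hA t ⟨i, by have : (i : ℕ) < t := hit; omega⟩
    rwa [if_neg (by simpa [Fin.ext_iff] using (show (i : ℕ) < t from hit).ne)] at h
  have hdiag (t : Fin d) : (G * A) t t = m t := by
    have h := hA t (Fin.last t)
    rwa [if_pos rfl] at h
  simp only [hdiag] at hperm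
  rw [← hperm]
  exact permanent_mul_mem_doubledPermIdeal k hchar A
end

section
/- Let k be a field, let M = (x_{i,j}) be the generic d×d matrix over k, and let I be the ideal of k[x_{i,j}] generated by the permanents of all d×d submatrices of the d×2d matrix (M | M) obtained by placing two copies of M side by side. Let I_{d-1}(d,d) be the ideal generated by all (d-1)×(d-1) subpermanents of M. Then (det M) · I_{d-1}(d,d) ⊆ I; that is, for every (d-1)×(d-1) subpermanent p of M, the product (det M) · p lies in I. -/
open MvPolynomial

/-- Laplace expansion of the permanent along the first column. -/
theorem permanent_eq_sum_column_zero {R : Type*} [CommRing R] {n : ℕ}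
    (A : Matrix (Fin (n + 1)) (Fin (n + 1)) R) :
    A.permanent = ∑ p, A p 0 *
      (Matrix.of fun a b : Fin n => A (Equiv.swap 0 p a.succ) b.succ).permanent := by
  simp only [Matrix.permanent, Finset.mul_sum]
  rw [← Fintype.sum_prod_type']
  refine Fintype.sum_equiv Equiv.Perm.decomposeFin _ _ fun σ => ?_
  obtain ⟨⟨p, e⟩, rfl⟩ := Equiv.Perm.decomposeFin.symm.surjective σ
  simp [Fin.prod_univ_succ]

/-- Deleting row `p` in any two ways gives the same permanent. -/
theorem permanent_swap_succ_eq {R : Type*} [CommRing R] {n : ℕ}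
    (B : Fin (n + 1) → Fin n → R) {r : Fin n → Fin (n + 1)} (hr : Function.Injective r)
    {p : Fin (n + 1)} (hp : ∀ a, r a ≠ p) :
    (Matrix.of fun a b => B (Equiv.swap 0 p a.succ) b).permanent =
      (Matrix.of fun a b => B (r a) b).permanent := by
  have h (a : Fin n) : ∃ x : Fin n, x.succ = Equiv.swap 0 p (r a) := by
    refine Fin.exists_succ_eq.2 fun h0 => hp a ?_
    rw [← Equiv.swap_apply_self 0 p (r a), h0, Equiv.swap_apply_left]
  choose f hf using h
  have hinj : Function.Injective f := fun a b hab =>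
    hr ((Equiv.swap 0 p).injective (by rw [← hf, ← hf, hab]))
  rw [← Matrix.permanent_permute_cols (Equiv.ofBijective f (Finite.injective_iff_bijective.1 hinj))]
  congr 1
  ext a b
  simp [Matrix.submatrix, hf]

theorem permanent_cons_mem_doubledPermIdeal (k : Type*) [Field k] {n : ℕ}
    {c : Fin n → Fin (n + 1)} (hc : StrictMono c) (j : Fin (n + 1)) :
    Matrix.permanent (Matrix.of fun i b =>
      (X (i, (Fin.cons j c : Fin (n + 1) → Fin (n + 1)) b) :
        MvPolynomial (Fin (n + 1) × Fin (n + 1)) k)) ∈ doubledPermIdeal k (n + 1) := by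
  refine Ideal.subset_span ⟨Fin.cons ⟨j, by omega⟩ fun b => ⟨n + 1 + c b, by omega⟩, ?_, ?_⟩
  · intro a b hab
    induction b using Fin.cases with
    | zero => simp at hab
    | succ b =>
      induction a using Fin.cases with
      | zero => simp [Fin.lt_def]; omega
      | succ a =>
        have := hc (Fin.succ_lt_succ_iff.1 hab)
        simp only [Fin.cons_succ, Fin.lt_def] at this ⊢
        omega
  · congr 1
    ext1 i b
    induction b using Fin.cases with
    | zero => simp only [Matrix.of_apply, Fin.cons_zero, dblCol, j.isLt, dite_true, Fin.eta]
    | succ b => simp [dblCol, show ¬ n + 1 + (c b : ℕ) ≤ n by omega]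

/-- `(det M) · I_{d-1}(d,d) ⊆ I`: for every `(d-1) × (d-1)` subpermanent `p` of the
generic `d × d` matrix `M`, the product `(det M) · p` lies in the ideal of `d × d`
permanents of `(M | M)`. -/
theorem stmt17 (k : Type*) [Field k] (d : ℕ)
    (r c : Fin (d - 1) → Fin d) (hr : StrictMono r) (hc : StrictMono c) :
    Matrix.det (Matrix.of fun (i j : Fin d) => (X (i, j) : MvPolynomial (Fin d × Fin d) k)) *
        Matrix.permanent (Matrix.of fun (a b : Fin (d - 1)) =>
          (X (r a, c b) : MvPolynomial (Fin d × Fin d) k)) ∈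
      doubledPermIdeal k d := by
  obtain _ | n := d
  · refine Ideal.mul_mem_left _ _ (Ideal.subset_span ⟨Fin.elim0, fun a => a.elim0, ?_⟩)
    simp [Matrix.permanent]
  change Fin n → Fin (n + 1) at r c
  obtain ⟨p, hp⟩ : ∃ p, ∀ a, r a ≠ p := by
    by_contra! h
    simpa using Fintype.card_le_of_surjective r h
  set M := Matrix.of fun (i j : Fin (n + 1)) =>
    (X (i, j) : MvPolynomial (Fin (n + 1) × Fin (n + 1)) k)
  set P : Fin (n + 1) → MvPolynomial (Fin (n + 1) × Fin (n + 1)) k := fun q =>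
    (Matrix.of fun a b : Fin n => M (Equiv.swap 0 q a.succ) (c b)).permanent with hP
  -- Expand the permanent with first column `(det M) e_p = ∑ j, (adj M)_{j,p} (column j)`.
  have key : M.det * P p = ∑ j, M.adjugate j p * Matrix.permanent (Matrix.of fun i b =>
      M i ((Fin.cons j c : Fin (n + 1) → Fin (n + 1)) b)) := by
    calc M.det * P p = ∑ q, (M * M.adjugate) q p * P q := by
          simp [Matrix.mul_adjugate, Matrix.smul_apply, Matrix.one_apply]
      _ = ∑ q, ∑ j, M.adjugate j p * (M q j * P q) := by
          simp only [Matrix.mul_apply, Finset.sum_mul]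
          exact Finset.sum_congr rfl fun q _ => Finset.sum_congr rfl fun j _ => by ring
      _ = _ := by
          rw [Finset.sum_comm]
          simp only [permanent_eq_sum_column_zero (Matrix.of _), Finset.mul_sum]
          simp [hP]
  have hminor : P p = (Matrix.of fun a b : Fin n => M (r a) (c b)).permanent :=
    permanent_swap_succ_eq (fun i b => M i (c b)) hr.injective hp
  change M.det * (Matrix.of fun a b : Fin n => M (r a) (c b)).permanent ∈ _
  rw [← hminor, key]
  exact Ideal.sum_mem _ fun j _ =>
    Ideal.mul_mem_left _ _ (permanent_cons_mem_doubledPermIdeal k hc j)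
end

section
/- Let q be a prime power, let k = F_q be the finite field with q elements, and suppose q ≥ d ≥ 4. Then for every invertible d×d matrix A over k there exists a vector v ∈ k^d such that every coordinate of v is nonzero and every coordinate of Av is nonzero. -/
open MvPolynomial in
/-- A permanent is the coefficient of the product of all variables in the product of the row
forms. -/
theorem Matrix.coeff_prod_row_forms_eq_permanent {ι R : Type*} [Fintype ι] [DecidableEq ι]
    [CommRing R] (A : Matrix ι ι R) :
    (∏ i, ∑ j, C (A i j) * X j : MvPolynomial ι R).coeff (Finsupp.equivFunOnFinite.symm 1) =
      A.permanent := by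
  have hterm (φ : ι → ι) : (∏ i, C (A i (φ i)) * X (φ i) : MvPolynomial ι R) =
      monomial (∑ i, Finsupp.single (φ i) 1) (∏ i, A i (φ i)) := by
    rw [monomial_sum_index]
    simp [Finset.prod_mul_distrib, X]
  have hbij (φ : ι → ι) : (∑ i, Finsupp.single (φ i) 1 : ι →₀ ℕ) =
      Finsupp.equivFunOnFinite.symm 1 ↔ Function.Bijective φ := by
    constructor
    · intro h
      refine Finite.surjective_iff_bijective.1 fun j ↦ ?_
      by_contra! hj
      have := DFunLike.congr_fun h j
      simp [Finsupp.finsetSum_apply, hj] at this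
    · intro h
      ext j
      rw [Finsupp.finsetSum_apply, h.sum_comp (fun i ↦ (Finsupp.single i 1 : ι →₀ ℕ) j)]
      simp [Finsupp.single_apply]
  rw [← Matrix.permanent_transpose, Matrix.permanent, Finset.prod_univ_sum, coeff_sum]
  simp_rw [hterm, coeff_monomial, hbij]
  rw [← Finset.sum_filter]
  refine (Finset.sum_bij (fun (σ : Equiv.Perm ι) _ ↦ (σ : ι → ι)) ?_ ?_ ?_ ?_).symm
  · intro σ _
    simp
  · intro σ _ τ _ h
    exact DFunLike.coe_injective h
  · intro φ hφ
    exact ⟨Equiv.ofBijective φ (by simpa using hφ), by simp, rfl⟩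
  · simp

theorem Matrix.permanent_eq_det_of_two_eq_zero {ι R : Type*} [Fintype ι] [DecidableEq ι]
    [CommRing R] (h2 : (2 : R) = 0) (A : Matrix ι ι R) :
    A.permanent = A.det := by
  rw [Matrix.permanent, Matrix.det_apply]
  refine Finset.sum_congr rfl fun σ _ ↦ ?_
  have hneg (x : R) : -x = x := by linear_combination -x * h2
  rcases Int.units_eq_one_or (Equiv.Perm.sign σ) with h | h <;> simp [h, hneg]

open Polynomial in
theorem Polynomial.coeff_X_add_C_pow_mul_mul {R : Type*} [CommRing R] (n : ℕ) (s a b : R) :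
    ((X + C s) ^ (n + 2) * ((X + C (a + s)) * (X + C (b + s)))).coeff (n + 2) =
      (n + 4).choose 2 * s ^ 2 + (n + 3) * (a + b) * s + a * b := by
  have hexpand : (X + C s) ^ (n + 2) * ((X + C (a + s)) * (X + C (b + s))) =
      (X + C s) ^ (n + 2) * X ^ 2 + (X + C s) ^ (n + 2) * C (a + b + 2 * s) * X +
        (X + C s) ^ (n + 2) * C ((a + s) * (b + s)) := by
    simp only [map_add, map_mul, map_ofNat]
    ring
  rw [hexpand, coeff_add, coeff_add, coeff_mul_X_pow, coeff_mul_X, coeff_mul_C, coeff_mul_C,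
    coeff_X_add_C_pow, coeff_X_add_C_pow, coeff_X_add_C_pow]
  have h1 : (n + 2).choose (n + 1) = n + 2 := by simp
  have h2 : (n + 2).choose n = (n + 2).choose 2 := (Nat.choose_symm_add (a := n) (b := 2))
  have h3 : (n + 4).choose 2 = (n + 2).choose 2 + 2 * n + 5 := by
    have e1 : (n + 4).choose 2 = (n + 3).choose 1 + (n + 3).choose 2 := Nat.choose_succ_succ _ _
    have e2 : (n + 3).choose 2 = (n + 2).choose 1 + (n + 2).choose 2 := Nat.choose_succ_succ _ _
    rw [e1, e2, Nat.choose_one_right, Nat.choose_one_right]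
    ring
  have h4 : n + 2 - (n + 1) = 1 := by omega
  simp only [h1, h2, h3, h4, Nat.choose_self, Nat.sub_self, Nat.add_sub_cancel_left]
  push_cast
  ring

open Polynomial in
/-- The second elementary symmetric function does not vanish identically on the affine space
of vectors `z - (τ + t(z)) • 1`. -/
theorem exists_coeff_prod_X_add_C_sub_ne_zero {ι k : Type*} [Fintype ι] [DecidableEq ι] [Field k]
    (S : Finset ι) (n : ℕ) (hS : S.card = n + 4) (τ : k) (t : ι → k)
    (h : ((S.card.choose 2 : k) = 0 ∧ (S.card : k) = 0 ∧ τ = 0) ∨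
      ((S.card.choose 2 : k) = 1 ∧ (S.card : k) = -1)) :
    ∃ z : ι → k, (∀ i ∉ S, z i = 0) ∧
      (∏ i ∈ S, (X + C (z i - (τ + ∑ i, t i * z i)))).coeff (n + 2) ≠ 0 := by
  by_contra! hz
  have key (i : ι) (hi : i ∈ S) (j : ι) (hj : j ∈ S) (hij : i ≠ j) (a b : k) :
      (S.card.choose 2 : k) * (τ + a * t i + b * t j) ^ 2 -
        (S.card - 1) * (a + b) * (τ + a * t i + b * t j) + a * b = 0 := by
    have hz' := hz (Pi.single i a + Pi.single j b) (by
      intro l hl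
      have h1 : l ≠ i := fun h ↦ hl (h ▸ hi)
      have h2 : l ≠ j := fun h ↦ hl (h ▸ hj)
      simp [h1, h2])
    have hsum : τ + ∑ l, t l * (Pi.single i a + Pi.single j b : ι → k) l =
        τ + a * t i + b * t j := by
      simp [mul_add, Finset.sum_add_distrib, Pi.single_apply]
      ring
    rw [hsum] at hz'
    set s := τ + a * t i + b * t j
    have hj' : j ∈ S.erase i := Finset.mem_erase.2 ⟨hij.symm, hj⟩
    rw [← Finset.mul_prod_erase S _ hi, ← Finset.mul_prod_erase (S.erase i) _ hj',
      Finset.prod_congr rfl (g := fun _ ↦ X + C (-s)) (by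
        intro l hl
        simp only [Finset.mem_erase] at hl
        simp [hl.1, hl.2.1]),
      Finset.prod_const, Finset.card_erase_of_mem hj', Finset.card_erase_of_mem hi, hS,
      show n + 4 - 1 - 1 = n + 2 by omega] at hz'
    have hc := Polynomial.coeff_X_add_C_pow_mul_mul n (-s) a b
    rw [← mul_assoc, mul_comm] at hz'
    simp only [Pi.add_apply, Pi.single_eq_same, Pi.single_eq_of_ne hij,
      Pi.single_eq_of_ne hij.symm, add_zero, zero_add, sub_eq_add_neg] at hz'
    rw [hz'] at hc
    rw [hS]
    push_cast
    linear_combination -hc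
  obtain ⟨i, hi, j, hj, l, hl, hij, hil, hjl⟩ := Finset.two_lt_card.1 (by omega : 2 < S.card)
  rcases h with ⟨hc, hw, rfl⟩ | ⟨hc, hw⟩
  · simp only [hc, hw] at key
    have e1 := key i hi j hj hij 1 0
    have e2 := key i hi j hj hij 0 1
    have e3 := key i hi j hj hij 1 1
    exact one_ne_zero (by linear_combination e3 - 2 * e1 - 2 * e2 : (1 : k) = 0)
  · simp only [hc, hw] at key
    have hτ : τ = 0 := by simpa using key i hi j hj hij 0 0
    subst hτ
    have hroot (x : k) (hx : x ^ 2 + 2 * x = 0) : x = 0 ∨ x = -2 := by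
      rcases mul_eq_zero.1 (by linear_combination hx : x * (x + 2) = 0) with h | h
      · exact .inl h
      · exact .inr (by linear_combination h)
    have hne {i j : ι} (hi : i ∈ S) (hj : j ∈ S) (hij : i ≠ j) : t i ≠ t j := by
      intro ht
      have e3 := key i hi j hj hij 1 1
      rcases hroot (t i) (by linear_combination key i hi j hj hij 1 0) with h | h <;>
      · rw [← ht, h] at e3
        exact one_ne_zero (by linear_combination e3 : (1 : k) = 0)
    have hti := hroot (t i) (by linear_combination key i hi j hj hij 1 0)
    have htj := hroot (t j) (by linear_combination key i hi j hj hij 0 1)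
    have htl := hroot (t l) (by linear_combination key i hi l hl hil 0 1)
    have := hne hi hj hij
    have := hne hi hl hil
    have := hne hj hl hjl
    grind

open MvPolynomial in
theorem MvPolynomial.exists_coeff_ne_zero_of_coeff_aeval_ne_zero {σ k : Type*} [Fintype σ]
    [DecidableEq σ] [CommRing k] (f : MvPolynomial σ k) (j : σ) (x : σ → k) (r : ℕ)
    (h : (aeval (Function.update (fun i ↦ Polynomial.C (x i)) j Polynomial.X) f).coeff r ≠ 0) :
    ∃ m, f.coeff m ≠ 0 ∧ m j = r := by
  rw [aeval_def, eval₂_eq', Polynomial.finsetSum_coeff] at h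
  obtain ⟨m, hm, hmr⟩ := Finset.exists_ne_zero_of_sum_ne_zero h
  refine ⟨m, mem_support_iff.1 hm, ?_⟩
  by_contra hne
  apply hmr
  rw [← Finset.mul_prod_erase _ _ (Finset.mem_univ j), Finset.prod_congr rfl
    (g := fun i ↦ Polynomial.C (x i ^ m i)) (by
      intro i hi
      simp [(Finset.mem_erase.1 hi).1]), ← map_prod]
  simp only [Function.update_self, Polynomial.algebraMap_eq, Polynomial.coeff_C_mul,
    Polynomial.coeff_mul_C, Polynomial.coeff_X_pow, if_neg (Ne.symm hne), zero_mul, mul_zero]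

open MvPolynomial in
/-- If column `j` of an invertible matrix has `n + 4` nonzero entries, then under suitable
congruences for `n + 4` the product of the row forms has a monomial of degree `n + 2` in the
variable `j`. -/
theorem Matrix.exists_coeff_prod_row_forms_ne_zero {ι k : Type*} [Fintype ι] [DecidableEq ι]
    [Field k] (A : Matrix ι ι k) (hA : IsUnit A) (j : ι) (S : Finset ι)
    (hSj : ∀ i, i ∈ S ↔ A i j ≠ 0) (n : ℕ) (hS : S.card = n + 4)
    (h : ((S.card.choose 2 : k) = 0 ∧ (S.card : k) = 0 ∧ S = Finset.univ) ∨
      ((S.card.choose 2 : k) = 1 ∧ (S.card : k) = -1)) :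
    ∃ m, (∏ i, ∑ l, C (A i l) * X l : MvPolynomial ι k).coeff m ≠ 0 ∧ m j = n + 2 := by
  have hdet := A.isUnit_iff_isUnit_det.1 hA
  let y₀ : ι → k := fun i ↦ if i ∈ S then 0 else 1
  obtain ⟨z, hz, hcoeff⟩ := exists_coeff_prod_X_add_C_sub_ne_zero S n hS
    (∑ i, A⁻¹ j i * y₀ i) (fun i ↦ A⁻¹ j i * A i j)
    (h.imp_left fun ⟨h, h', hu⟩ ↦ ⟨h, h', by simp [y₀, hu]⟩)
  let y : ι → k := fun i ↦ y₀ i + A i j * z i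
  let x : ι → k := A⁻¹.mulVec y
  have hx : A.mulVec x = y := by
    simp [x, Matrix.mulVec_mulVec, Matrix.mul_nonsing_inv _ hdet]
  have hxj : ∑ i, A⁻¹ j i * y₀ i + ∑ i, A⁻¹ j i * A i j * z i = x j := by
    simp [x, y, Matrix.mulVec, dotProduct, mul_add, Finset.sum_add_distrib, mul_assoc]
  rw [hxj] at hcoeff
  refine exists_coeff_ne_zero_of_coeff_aeval_ne_zero _ j x _ ?_
  have hrow (i : ι) : aeval (Function.update (fun i ↦ Polynomial.C (x i)) j Polynomial.X)
      (∑ l, C (A i l) * X l : MvPolynomial ι k) =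
      Polynomial.C (A i j) * Polynomial.X + Polynomial.C (y i - A i j * x j) := by
    have hy : y i = A i j * x j + ∑ l ∈ Finset.univ.erase j, A i l * x l := by
      rw [← hx, Finset.add_sum_erase _ (fun l ↦ A i l * x l) (Finset.mem_univ j)]
      rfl
    rw [hy, add_sub_cancel_left, map_sum, ← Finset.add_sum_erase _ _ (Finset.mem_univ j), map_sum]
    congr 1
    · simp
    · refine Finset.sum_congr rfl fun l hl ↦ ?_
      simp [(Finset.mem_erase.1 hl).1]
  have hfactor (i : ι) : Polynomial.C (A i j) * Polynomial.X + Polynomial.C (y i - A i j * x j) =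
      Polynomial.C (if i ∈ S then A i j else 1) *
        if i ∈ S then Polynomial.X + Polynomial.C (z i - x j) else 1 := by
    by_cases hi : i ∈ S
    · simp only [hi, if_true, y, y₀, mul_add, ← Polynomial.C_mul]
      congr 2
      ring
    · have h0 : A i j = 0 := by simpa [hi] using hSj i
      simp [hi, y, y₀, h0]
  simp_rw [map_prod, hrow, hfactor, Finset.prod_mul_distrib, ← map_prod, Polynomial.coeff_C_mul]
  refine mul_ne_zero (Finset.prod_ne_zero_iff.2 fun i _ ↦ ?_) ?_
  · split_ifs with hi
    · exact (hSj i).1 hi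
    · exact one_ne_zero
  · rwa [Finset.prod_ite_mem, Finset.univ_inter]

/-- The values of the binomial coefficients `q.choose 2` and `(q - 1).choose 2` over
a finite field with `q` elements and odd characteristic. -/
theorem FiniteField.cast_choose_two {k : Type*} [Field k] [Fintype k] (h2 : (2 : k) ≠ 0) (w : ℕ)
    (hw : w = Fintype.card k ∨ w + 1 = Fintype.card k) :
    ((w.choose 2 : k) = 0 ∧ (w : k) = 0 ∧ w = Fintype.card k) ∨
      ((w.choose 2 : k) = 1 ∧ (w : k) = -1) := by
  have hq : (Fintype.card k : k) = 0 := FiniteField.cast_card_eq_zero k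
  have hc : (2 : k) * w.choose 2 = w * (w - 1) := by
    rcases w with _ | w
    · simp
    · have h : (w + 1) * w.choose 1 = (w + 1).choose 2 * 2 := Nat.add_one_mul_choose_eq w 1
      rw [Nat.choose_one_right] at h
      have h' : ((w + 1 : ℕ) : k) * w = ((w + 1).choose 2 : k) * 2 :=
        mod_cast congrArg (Nat.cast (R := k)) h
      rw [mul_comm, ← h']
      push_cast
      ring
  rcases hw with hw | hw
  · have h0 : (w : k) = 0 := by rw [hw, hq]
    refine .inl ⟨?_, h0, hw⟩
    rw [h0, zero_mul] at hc
    exact (mul_eq_zero.1 hc).resolve_left h2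
  · have h1 : (w : k) = -1 := by
      rw [← hw] at hq
      push_cast at hq
      linear_combination hq
    refine .inr ⟨mul_left_cancel₀ h2 ?_, h1⟩
    rw [hc, h1]
    ring

open MvPolynomial in
theorem Matrix.isHomogeneous_prod_row_forms {ι R : Type*} [Fintype ι] [CommRing R]
    (A : Matrix ι ι R) :
    (∏ i, ∑ j, C (A i j) * X j : MvPolynomial ι R).IsHomogeneous (Fintype.card ι) := by
  have := IsHomogeneous.prod Finset.univ (fun i ↦ (∑ j, C (A i j) * X j : MvPolynomial ι R))
    (fun _ ↦ 1) (fun i _ ↦ IsHomogeneous.sum _ _ _ fun j _ ↦ isHomogeneous_C_mul_X _ _)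
  simpa using this

open MvPolynomial in
/-- For `4 ≤ d ≤ q`, the product of the row forms of an invertible matrix has a monomial all of
whose exponents are at most `q - 2`. -/
theorem Matrix.exists_coeff_prod_row_forms_ne_zero_lt {k : Type*} [Field k] [Fintype k] (d : ℕ)
    (hd : 4 ≤ d) (hq : d ≤ Fintype.card k) (A : Matrix (Fin d) (Fin d) k) (hA : IsUnit A) :
    ∃ m, (∏ i, ∑ l, C (A i l) * X l : MvPolynomial (Fin d) k).coeff m ≠ 0 ∧
      ∀ j, m j < Fintype.card k - 1 := by
  classical
  by_cases h2 : (2 : k) = 0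
  · refine ⟨Finsupp.equivFunOnFinite.symm 1, ?_, fun j ↦ ?_⟩
    · rw [A.coeff_prod_row_forms_eq_permanent, Matrix.permanent_eq_det_of_two_eq_zero h2]
      exact (A.isUnit_iff_isUnit_det.1 hA).ne_zero
    · simp
      omega
  have hq5 : 5 ≤ Fintype.card k := by
    by_contra hlt
    have hc : (Fintype.card k : k) = 0 := FiniteField.cast_card_eq_zero k
    rw [show Fintype.card k = 4 by omega] at hc
    exact h2 (pow_eq_zero_iff two_ne_zero |>.1 (by push_cast at hc; linear_combination hc))
  set f : MvPolynomial (Fin d) k := ∏ i, ∑ l, C (A i l) * X l with hf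
  have hrow (i : Fin d) : (∑ l, C (A i l) * X l : MvPolynomial (Fin d) k) ≠ 0 := by
    intro h0
    refine (A.isUnit_iff_isUnit_det.1 hA).ne_zero (Matrix.det_eq_zero_of_row_eq_zero i fun j ↦ ?_)
    have := congrArg (eval (Pi.single j 1)) h0
    simpa [Pi.single_apply] using this
  have hf0 : f ≠ 0 := Finset.prod_ne_zero_iff.2 fun i _ ↦ hrow i
  let S (j : Fin d) : Finset (Fin d) := {i | A i j ≠ 0}
  by_cases hS : ∀ j, (S j).card < Fintype.card k - 1
  · obtain ⟨m, hm⟩ := support_nonempty.2 hf0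
    refine ⟨m, mem_support_iff.1 hm, fun j ↦ lt_of_le_of_lt ?_ (hS j)⟩
    calc m j ≤ f.degreeOf j := monomial_le_degreeOf j hm
      _ ≤ ∑ i, (∑ l, C (A i l) * X l : MvPolynomial (Fin d) k).degreeOf j :=
        degreeOf_prod_le _ _ _
      _ ≤ ∑ i, if A i j ≠ 0 then 1 else 0 := by
        refine Finset.sum_le_sum fun i _ ↦ (degreeOf_sum_le _ _ _).trans ?_
        refine Finset.sup_le fun l _ ↦ ?_
        by_cases hil : A i l = 0
        · simp [hil]
        · refine (degreeOf_C_mul_le _ _ _).trans ?_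
          rw [degreeOf_X]
          grind
      _ = (S j).card := (Finset.card_filter _ _).symm
  · push Not at hS
    obtain ⟨j, hj⟩ := hS
    have hle : (S j).card ≤ d := (Finset.card_le_univ _).trans_eq (Fintype.card_fin d)
    obtain ⟨n, hn⟩ := Nat.exists_eq_add_of_le' (show 4 ≤ (S j).card by omega)
    obtain ⟨m, hm, hmj⟩ := A.exists_coeff_prod_row_forms_ne_zero hA j (S j) (by simp [S]) n hn
      ((FiniteField.cast_choose_two h2 (S j).card (by omega)).imp_left fun ⟨h, h', hc⟩ ↦
        ⟨h, h', Finset.card_eq_iff_eq_univ _ |>.1 (by rw [Fintype.card_fin]; omega)⟩)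
    refine ⟨m, hm, fun l ↦ ?_⟩
    have hdeg : ∑ i, m i = d := by
      have := A.isHomogeneous_prod_row_forms hm
      rw [Finsupp.weight_apply, Finsupp.sum_fintype _ _ (by simp)] at this
      simpa using this
    by_cases hlj : l = j
    · subst hlj
      omega
    · have : m j + m l ≤ ∑ i, m i := by
        rw [← Finset.sum_pair (Ne.symm hlj)]
        exact Finset.sum_le_sum_of_subset (Finset.subset_univ _)
      omega

/-- The Alon–Jaeger–Tarsi statement for `q ≥ d ≥ 4`: over the finite field with `q`
elements, every invertible `d × d` matrix `A` admits a vector `v` such that both `v`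
and `A v` have no zero component. -/
theorem stmt18 (k : Type*) [Field k] [Fintype k] (d : ℕ)
    (hd : 4 ≤ d) (hq : d ≤ Fintype.card k)
    (A : Matrix (Fin d) (Fin d) k) (hA : IsUnit A) :
    ∃ v : Fin d → k, (∀ i, v i ≠ 0) ∧ (∀ i, A.mulVec v i ≠ 0) := by
  classical
  obtain ⟨m, hm, hlt⟩ := A.exists_coeff_prod_row_forms_ne_zero_lt d hd hq hA
  have hhom := A.isHomogeneous_prod_row_forms
  have hdeg : m.degree = Fintype.card (Fin d) := by
    rw [Finsupp.degree_eq_weight_one]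
    exact hhom hm
  obtain ⟨v, hv, hev⟩ := MvPolynomial.combinatorial_nullstellensatz_exists_eval_nonzero _ m hm
    ((hhom.totalDegree fun h ↦ hm (by simp [h])).trans hdeg.symm)
    (fun _ ↦ Finset.univ.erase 0) (fun j ↦ by
      rw [Finset.card_erase_of_mem (Finset.mem_univ _)]
      exact hlt j)
  refine ⟨v, fun i ↦ Finset.ne_of_mem_erase (hv i), fun i ↦ ?_⟩
  rw [map_prod, Finset.prod_ne_zero_iff] at hev
  simpa [Matrix.mulVec, dotProduct] using hev i (Finset.mem_univ i)
end
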